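/- arXiv:2312.13988 — 3 statements merged into one kernel-verified Lean document; each statement's English description precedes it below -/
import Mathlib

section
/- For every irrational x ∈ (0,1) and every n ≥ 0, one has s_n(x)·|s_n(x)·x − u_n(x)| = h(x_n, y_n), where (x_n, y_n) = F̄^n(x,1). Consequently, for every proper inducible subregion R ⊆ Ω and every irrational x ∈ (0,1) whose orbit F̄^k(x,1) enters R for infinitely many k ≥ 1, one has Θ_n^R(x) = h(x_n^R, y_n^R) for all n ≥ 0. -/
open MeasureTheory Filter Topology
open scoped Classical

noncomputable section

/-- The Farey tent map `F`. -/
def fareyMap (x : ℝ) : ℝ := if x ≤ 1/2 then x / (1 - x) else (1 - x) / x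

/-- `eps x n = ε_{n+1}(x)`, i.e. `0` if `F^[n] x ≤ 1/2` and `1` otherwise. -/
def eps (x : ℝ) (n : ℕ) : ℤ := if fareyMap^[n] x ≤ 1/2 then 0 else 1

/-- The matrices `A_0 = [[1,0],[1,1]]` and `A_1 = [[0,1],[1,1]]`. -/
def Amat (e : ℤ) : Matrix (Fin 2) (Fin 2) ℤ := !![1 - e, e; 1, 1]

/-- `Mmat x n = A_{ε_1(x)} ⋯ A_{ε_n(x)}`, with `Mmat x 0` the identity. -/
def Mmat (x : ℝ) : ℕ → Matrix (Fin 2) (Fin 2) ℤ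
  | 0 => 1
  | n + 1 => Mmat x n * Amat (eps x n)

/-- `u_n(x)`: top-left entry of `M_n(x)`. -/
def uF (x : ℝ) (n : ℕ) : ℤ := Mmat x n 0 0

/-- `s_n(x)`: bottom-left entry of `M_n(x)`. -/
def sF (x : ℝ) (n : ℕ) : ℤ := Mmat x n 1 0

/-- Ito's natural extension `F̄` of the Farey tent map. -/
def fareyNE (p : ℝ × ℝ) : ℝ × ℝ :=
  if p.1 ≤ 1/2 then (p.1 / (1 - p.1), p.2 / (1 + p.2))
  else ((1 - p.1) / p.1, 1 / (1 + p.2))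

/-- `Ω = [0,1]²`. -/
def OmegaSet : Set (ℝ × ℝ) := Set.Icc (0:ℝ) 1 ×ˢ Set.Icc (0:ℝ) 1

/-- The measure `μ̄` on `Ω` with density `(x + y − xy)⁻²` w.r.t. Lebesgue measure. -/
def muBar : Measure (ℝ × ℝ) :=
  (volume.restrict OmegaSet).withDensity
    (fun p => ENNReal.ofReal (1 / (p.1 + p.2 - p.1 * p.2) ^ 2))

/-- A proper inducible subregion of `Ω`. -/
def ProperInducible (R : Set (ℝ × ℝ)) : Prop :=
  R ⊆ OmegaSet ∧ MeasurableSet R ∧ 0 < muBar R ∧ muBar R < ⊤ ∧ muBar (frontier R) = 0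

/-- `hitsR R x k` holds iff `k ≥ 1` and `F̄^[k] (x,1) ∈ R`. -/
def hitsR (R : Set (ℝ × ℝ)) (x : ℝ) (k : ℕ) : Prop := 1 ≤ k ∧ fareyNE^[k] (x, 1) ∈ R

/-- `Nidx R x n = N_n`: `N_0 = 0` and, for `n ≥ 1`, the `n`-th smallest `k ≥ 1`
with `F̄^[k] (x,1) ∈ R`. -/
def Nidx (R : Set (ℝ × ℝ)) (x : ℝ) : ℕ → ℕ
  | 0 => 0
  | n + 1 => Nat.nth (hitsR R x) n

/-- `h(x,y) = (1−y)/(x + y − xy)`. -/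
def hIto (p : ℝ × ℝ) : ℝ := (1 - p.2) / (p.1 + p.2 - p.1 * p.2)

/-- `Θ_n(x) = s_n(x)·|s_n(x)·x − u_n(x)|`, the approximation coefficient of the
`n`-th Farey convergent `u_n(x)/s_n(x)`. -/
def ThetaF (x : ℝ) (n : ℕ) : ℝ := (sF x n : ℝ) * |(sF x n : ℝ) * x - (uF x n : ℝ)|

/-- `Θ_n^R(x) = s_n^R·|s_n^R·x − u_n^R|` where `u_n^R = u_{N_n}(x)`, `s_n^R = s_{N_n}(x)`. -/
def ThetaR (R : Set (ℝ × ℝ)) (x : ℝ) (n : ℕ) : ℝ := ThetaF x (Nidx R x n)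

/-- The Gauss map. -/
def gaussMap (x : ℝ) : ℝ := Int.fract (1 / x)

/-- `pquot x n` is the RCF partial quotient `a_{n+1}(x)`. -/
def pquot (x : ℝ) (n : ℕ) : ℤ := ⌊1 / (gaussMap^[n] x)⌋

/-- `pnum x (j+1)` is the RCF numerator `p_j(x)`; `pnum x 0 = p_{-1} = 1`. -/
def pnum (x : ℝ) : ℕ → ℤ
  | 0 => 1
  | 1 => 0
  | n + 2 => pquot x n * pnum x (n + 1) + pnum x n

/-- `qden x (j+1)` is the RCF denominator `q_j(x)`; `qden x 0 = q_{-1} = 0`. -/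
def qden (x : ℝ) : ℕ → ℤ
  | 0 => 0
  | 1 => 1
  | n + 2 => pquot x n * qden x (n + 1) + qden x n

/-- The approximation coefficient `Θ(x, p/q) = q·|q·x − p|`. -/
def Theta (x : ℝ) (p q : ℤ) : ℝ := (q : ℝ) * |(q : ℝ) * x - (p : ℝ)|

/-- `medTheta x l j = Θ(x, (l·p_j + p_{j−1})/(l·q_j + q_{j−1}))`. -/
def medTheta (x : ℝ) (l : ℤ) (j : ℕ) : ℝ :=
  Theta x (l * pnum x (j + 1) + pnum x j) (l * qden x (j + 1) + qden x j)

end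

/-- The first coordinate of `fareyNE` evolves by the Farey map. -/
theorem fareyNE_fst (p : ℝ × ℝ) : (fareyNE p).1 = fareyMap p.1 := by
  unfold fareyNE fareyMap
  split_ifs <;> rfl

theorem fareyNE_iterate_fst (p : ℝ × ℝ) (n : ℕ) :
    (fareyNE^[n] p).1 = fareyMap^[n] p.1 := by
  induction n with
  | zero => rfl
  | succ n ih => rw [Function.iterate_succ_apply', Function.iterate_succ_apply', fareyNE_fst, ih]

/-- The point `(X, Y)` of the orbit of `(x, 1)` is determined by the matrix
`[[u, t], [s, r]]` through `x = (u X + t) / (s X + r)` and `Y = r / (s + r)`. -/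
def FareyCoded (x : ℝ) (M : Matrix (Fin 2) (Fin 2) ℤ) (p : ℝ × ℝ) : Prop :=
  p.1 ∈ Set.Icc (0:ℝ) 1 ∧ (0:ℝ) ≤ M 1 0 ∧ (0:ℝ) < M 1 1 ∧
    p.2 = (M 1 1 : ℝ) / (M 1 0 + M 1 1) ∧
    x * (M 1 0 * p.1 + M 1 1) = M 0 0 * p.1 + M 0 1 ∧
    |(M 0 1 * M 1 0 - M 0 0 * M 1 1 : ℝ)| = 1

theorem FareyCoded.step {x : ℝ} {M : Matrix (Fin 2) (Fin 2) ℤ} {p : ℝ × ℝ}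
    (h : FareyCoded x M p) :
    FareyCoded x (M * Amat (if p.1 ≤ 1/2 then 0 else 1)) (fareyNE p) := by
  obtain ⟨X, Y⟩ := p
  obtain ⟨⟨hX0, hX1⟩, hs, hr, hY, hx, hdet⟩ := h
  dsimp only at *
  have hsr : (0:ℝ) < M 1 0 + M 1 1 := by linarith
  by_cases hX : X ≤ 1/2
  · have h1 : 0 < 1 - X := by linarith
    simp only [FareyCoded, fareyNE, hX, if_true, Amat, Matrix.mul_apply, Fin.sum_univ_two,
      Matrix.of_apply, Matrix.cons_val', Matrix.cons_val_zero, Matrix.cons_val_one,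
      Matrix.cons_val_fin_one, Set.mem_Icc]
    push_cast
    refine ⟨⟨by positivity, by rw [div_le_one h1]; linarith⟩, by linarith, by linarith, ?_, ?_, ?_⟩
    · rw [hY]
      field_simp
      ring
    · field_simp
      linear_combination hx
    · convert hdet using 2
      ring
  · have h1 : 0 < X := by linarith
    simp only [FareyCoded, fareyNE, hX, if_false, Amat, Matrix.mul_apply, Fin.sum_univ_two,
      Matrix.of_apply, Matrix.cons_val', Matrix.cons_val_zero, Matrix.cons_val_one,
      Matrix.cons_val_fin_one, Set.mem_Icc]
    push_cast
    refine ⟨⟨div_nonneg (by linarith) h1.le, by rw [div_le_one h1]; linarith⟩,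
      by linarith, by linarith, ?_, ?_, ?_⟩
    · rw [hY]
      field_simp
      ring
    · field_simp
      linear_combination hx
    · rw [← abs_neg]
      convert hdet using 2
      ring

theorem fareyCoded_Mmat {x : ℝ} (hx : x ∈ Set.Icc (0:ℝ) 1) (n : ℕ) :
    FareyCoded x (Mmat x n) (fareyNE^[n] (x, 1)) := by
  induction n with
  | zero => simpa [FareyCoded, Mmat] using hx
  | succ n ih =>
    rw [Function.iterate_succ_apply', Mmat, eps, ← fareyNE_iterate_fst (x, 1) n]
    exact ih.step

theorem FareyCoded.mul_abs_eq_hIto {x : ℝ} {M : Matrix (Fin 2) (Fin 2) ℤ} {p : ℝ × ℝ}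
    (h : FareyCoded x M p) :
    (M 1 0 : ℝ) * |(M 1 0 : ℝ) * x - M 0 0| = hIto p := by
  obtain ⟨X, Y⟩ := p
  obtain ⟨⟨hX0, hX1⟩, hs, hr, hY, hx, hdet⟩ := h
  dsimp only at *
  have hsr : (0:ℝ) < M 1 0 + M 1 1 := by linarith
  have hD : (0:ℝ) < M 1 0 * X + M 1 1 := by positivity
  have hdiff : (M 1 0 : ℝ) * x - M 0 0
      = (M 0 1 * M 1 0 - M 0 0 * M 1 1) / (M 1 0 * X + M 1 1) := by
    rw [eq_div_iff hD.ne']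
    linear_combination (M 1 0 : ℝ) * hx
  have hnum : 1 - Y = (M 1 0 : ℝ) / (M 1 0 + M 1 1) := by
    rw [hY]
    field_simp
    ring
  have hden : X + Y - X * Y = ((M 1 0 : ℝ) * X + M 1 1) / (M 1 0 + M 1 1) := by
    rw [hY]
    field_simp
    ring
  rw [hdiff, abs_div, hdet, abs_of_pos hD, hIto, hnum, hden, div_div_div_cancel_right₀ hsr.ne',
    mul_one_div]

theorem ThetaF_eq_hIto {x : ℝ} (hx : x ∈ Set.Icc (0:ℝ) 1) (n : ℕ) :
    ThetaF x n = hIto (fareyNE^[n] (x, 1)) :=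
  (fareyCoded_Mmat hx n).mul_abs_eq_hIto

/-- Proposition (Theta & h): `Θ_n(x) = h(F̄^n(x,1))` and, for any proper inducible
subregion `R` whose orbit of `(x,1)` enters `R` infinitely often, `Θ_n^R(x) = h(x_n^R, y_n^R)`. -/
theorem stmt_0 :
    (∀ x : ℝ, x ∈ Set.Ioo (0:ℝ) 1 → Irrational x → ∀ n : ℕ,
        (sF x n : ℝ) * |(sF x n : ℝ) * x - (uF x n : ℝ)| = hIto (fareyNE^[n] (x, 1))) ∧
    (∀ R : Set (ℝ × ℝ), ProperInducible R →
      ∀ x : ℝ, x ∈ Set.Ioo (0:ℝ) 1 → Irrational x →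
        {k : ℕ | hitsR R x k}.Infinite →
        ∀ n : ℕ, ThetaR R x n = hIto (fareyNE^[Nidx R x n] (x, 1))) := by
  exact ⟨fun x hx _ n => ThetaF_eq_hIto (Set.Ioo_subset_Icc_self hx) n,
    fun R _ x hx _ _ n => ThetaF_eq_hIto (Set.Ioo_subset_Icc_self hx) (Nidx R x n)⟩
end

section
/- For every irrational x ∈ (0,1) and every n ≥ 1, setting j_n := #{1 ≤ k ≤ n : ε_k(x) = 1} and λ_n := n − (a_1 + a_2 + ⋯ + a_{j_n}), one has 0 ≤ λ_n < a_{j_n+1} and M_n(x) = [[λ_n p_{j_n} + p_{j_n−1}, p_{j_n}], [λ_n q_{j_n} + q_{j_n−1}, q_{j_n}]]. -/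
open MeasureTheory Filter Topology
open scoped Classical

/-- Every iterate of the Gauss map sends an irrational point of `(0, 1)` to such a point. -/
theorem gaussMap_iterate_mem_Ioo_and_irrational {x : ℝ} (hx : x ∈ Set.Ioo (0 : ℝ) 1)
    (hirr : Irrational x) (j : ℕ) :
    gaussMap^[j] x ∈ Set.Ioo (0 : ℝ) 1 ∧ Irrational (gaussMap^[j] x) := by
  induction j with
  | zero => exact ⟨hx, hirr⟩
  | succ j ih =>
    rw [Function.iterate_succ_apply']
    have h : Irrational (gaussMap (gaussMap^[j] x)) := by
      unfold gaussMap Int.fract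
      rw [one_div]
      exact (irrational_inv_iff.2 ih.2).sub_intCast _
    exact ⟨⟨lt_of_le_of_ne (Int.fract_nonneg _) h.ne_zero.symm, Int.fract_lt_one _⟩, h⟩

/-- The partial quotients of an irrational point of `(0, 1)` are positive. -/
theorem pquot_pos {x : ℝ} (hx : x ∈ Set.Ioo (0 : ℝ) 1) (hirr : Irrational x) (j : ℕ) :
    0 < pquot x j := by
  obtain ⟨⟨h0, h1⟩, -⟩ := gaussMap_iterate_mem_Ioo_and_irrational hx hirr j
  exact Int.floor_pos.2 ((one_le_div h0).2 h1.le)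

/-- The number of indices `k < n` with `eps x k = 1`. -/
noncomputable def fareyIndex (x : ℝ) (n : ℕ) : ℕ := ((Finset.range n).filter fun k => eps x k = 1).card

theorem fareyIndex_succ_of_eps_eq_zero {x : ℝ} {n : ℕ} (h : eps x n = 0) :
    fareyIndex x (n + 1) = fareyIndex x n := by
  simp [fareyIndex, Finset.range_add_one, Finset.filter_insert, h]

theorem fareyIndex_succ_of_eps_eq_one {x : ℝ} {n : ℕ} (h : eps x n = 1) :
    fareyIndex x (n + 1) = fareyIndex x n + 1 := by
  simp [fareyIndex, Finset.range_add_one, Finset.filter_insert, h]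

/-- The offset of `n` from the sum of the first `fareyIndex x n` partial quotients. -/
noncomputable def fareyOffset (x : ℝ) (n : ℕ) : ℤ := (n : ℤ) - ∑ k ∈ Finset.range (fareyIndex x n), pquot x k

theorem fareyOffset_succ_of_eps_eq_zero {x : ℝ} {n : ℕ} (h : eps x n = 0) :
    fareyOffset x (n + 1) = fareyOffset x n + 1 := by
  rw [fareyOffset, fareyOffset, fareyIndex_succ_of_eps_eq_zero h]
  push_cast
  ring

theorem fareyOffset_succ_of_eps_eq_one {x : ℝ} {n : ℕ} (h : eps x n = 1) :
    fareyOffset x (n + 1) = fareyOffset x n + 1 - pquot x (fareyIndex x n) := by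
  rw [fareyOffset, fareyOffset, fareyIndex_succ_of_eps_eq_one h, Finset.sum_range_succ]
  push_cast
  ring

/-- The Farey orbit follows the Gauss orbit: with `j = fareyIndex x n` and `l = fareyOffset x n`,
the reciprocal of `F^[n] x` is that of `G^[j] x` lowered by `l`. The matrix `M_n` then has the
`l`-th mediant and the `j`-th convergent as columns. -/
theorem farey_orbit_and_Mmat {x : ℝ} (hx : x ∈ Set.Ioo (0 : ℝ) 1) (hirr : Irrational x) (n : ℕ) :
    0 < fareyMap^[n] x ∧
      1 / fareyMap^[n] x = 1 / gaussMap^[fareyIndex x n] x - fareyOffset x n ∧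
      0 ≤ fareyOffset x n ∧ fareyOffset x n < pquot x (fareyIndex x n) ∧
      Mmat x n = !![fareyOffset x n * pnum x (fareyIndex x n + 1) + pnum x (fareyIndex x n),
                      pnum x (fareyIndex x n + 1);
                    fareyOffset x n * qden x (fareyIndex x n + 1) + qden x (fareyIndex x n),
                      qden x (fareyIndex x n + 1)] := by
  induction n with
  | zero =>
    have hpos := pquot_pos hx hirr 0
    simpa [fareyIndex, fareyOffset, Mmat, pnum, qden, Matrix.one_fin_two, hpos] using hx.1
  | succ n ih =>
    obtain ⟨hy, hinv, hl, hlt, hM⟩ := ih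
    rw [Function.iterate_succ_apply', Mmat, hM]
    by_cases hle : fareyMap^[n] x ≤ 1 / 2
    · have he : eps x n = 0 := if_pos hle
      rw [fareyIndex_succ_of_eps_eq_zero he, fareyOffset_succ_of_eps_eq_zero he, he, fareyMap,
        if_pos hle]
      set y := fareyMap^[n] x
      have hy1 : 0 < 1 - y := by linarith
      have h2 : 2 ≤ 1 / y := by rw [le_div_iff₀ hy]; linarith
      refine ⟨div_pos hy hy1, ?_, by omega, ?_, ?_⟩
      · have : 1 / (y / (1 - y)) = 1 / y - 1 := by field_simp
        rw [this, hinv]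
        push_cast
        ring
      · rw [← Int.add_one_le_iff, pquot, Int.le_floor]
        push_cast
        linarith
      · ext i k
        fin_cases i <;> fin_cases k <;> simp [Amat, Matrix.mul_apply, Fin.sum_univ_two] <;> ring
    · have he : eps x n = 1 := if_neg hle
      have hlast : fareyOffset x n + 1 = pquot x (fareyIndex x n) := by
        have hy2 : 1 / fareyMap^[n] x < 2 := by
          rw [div_lt_iff₀ hy]
          linarith
        have : pquot x (fareyIndex x n) < fareyOffset x n + 2 := by
          rw [pquot, Int.floor_lt]
          push_cast
          linarith
        omega
      have hstep : fareyMap (fareyMap^[n] x) = gaussMap^[fareyIndex x n + 1] x := by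
        rw [fareyMap, if_neg hle, sub_div, div_self hy.ne', hinv, Function.iterate_succ_apply',
          gaussMap, Int.fract, ← pquot, ← hlast]
        push_cast
        ring
      rw [fareyIndex_succ_of_eps_eq_one he, fareyOffset_succ_of_eps_eq_one he, he, hstep, hlast,
        sub_self]
      refine ⟨(gaussMap_iterate_mem_Ioo_and_irrational hx hirr _).1.1, by simp, le_rfl,
        pquot_pos hx hirr _, ?_⟩
      ext i k
      fin_cases i <;> fin_cases k <;>
        simp [Amat, Matrix.mul_apply, Fin.sum_univ_two, pnum, qden, ← hlast] <;> ring

/-- With `j_n = #{1 ≤ k ≤ n : ε_k(x) = 1}` and `λ_n = n − (a_1 + ⋯ + a_{j_n})`, one has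
`0 ≤ λ_n < a_{j_n+1}` and
`M_n(x) = [[λ_n p_{j_n} + p_{j_n−1}, p_{j_n}], [λ_n q_{j_n} + q_{j_n−1}, q_{j_n}]]`. -/
theorem stmt_2 (x : ℝ) (hx : x ∈ Set.Ioo (0:ℝ) 1) (hirr : Irrational x)
    (n : ℕ) (hn : 1 ≤ n) :
    let j : ℕ := ((Finset.range n).filter fun k => eps x k = 1).card
    let lam : ℤ := (n : ℤ) - ∑ k ∈ Finset.range j, pquot x k
    0 ≤ lam ∧ lam < pquot x j ∧
      Mmat x n = !![lam * pnum x (j + 1) + pnum x j, pnum x (j + 1);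
                    lam * qden x (j + 1) + qden x j, qden x (j + 1)] := by
  exact (farey_orbit_and_Mmat hx hirr n).2.2
end

section
/- (Doeblin–Lenstra.) Let θ_n(x) := q_n² · |x − p_n/q_n|. For every irrational x ∈ (0,1) and every n ≥ 0, 0 < θ_n(x) < 1. Moreover, for Lebesgue-almost every irrational x ∈ (0,1) and every z ∈ [0,1]: lim_{n→∞} (1/n) · #{0 ≤ k < n : θ_k(x) ≤ z} = z/log 2 if 0 ≤ z ≤ 1/2, and = (1 − z + log(2z))/log 2 if 1/2 ≤ z ≤ 1. -/
open MeasureTheory Filter Topology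
open scoped Classical

/-- `θ_n(x) = q_n²·|x − p_n/q_n|`, the approximation coefficient of the `n`-th RCF convergent. -/
noncomputable def thetaRCF (x : ℝ) (n : ℕ) : ℝ :=
  (qden x (n + 1) : ℝ) ^ 2 * |x - (pnum x (n + 1) : ℝ) / (qden x (n + 1) : ℝ)|

namespace DoeblinLenstra

open Set

/-- A strong law of large numbers for bounded variables whose partial sums have linearly growing
second moments. -/
theorem ae_tendsto_average_zero {Ω : Type*} [MeasurableSpace Ω] {μ : Measure Ω}
    [IsFiniteMeasure μ] {Y : ℕ → Ω → ℝ} (hm : ∀ k, Measurable (Y k))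
    (hb : ∀ k ω, |Y k ω| ≤ 1) {C : ℝ}
    (hC : ∀ n : ℕ, ∫ ω, (∑ k ∈ Finset.range n, Y k ω) ^ 2 ∂μ ≤ C * n) :
    ∀ᵐ ω ∂μ, Tendsto (fun n : ℕ => (∑ k ∈ Finset.range n, Y k ω) / n) atTop (𝓝 0) := by
  set S : ℕ → Ω → ℝ := fun n ω => ∑ k ∈ Finset.range n, Y k ω with hS
  set Z : ℕ → Ω → ℝ := fun m ω => S ((m + 1) ^ 2) ω / ((m + 1 : ℝ) ^ 2) with hZ
  have hSm : ∀ n, Measurable (S n) := fun n => Finset.measurable_sum _ fun k _ => hm k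
  have hSb : ∀ n ω, |S n ω| ≤ n := fun n ω => by
    refine (Finset.abs_sum_le_sum_abs _ _).trans ((Finset.sum_le_sum fun k _ => hb k ω).trans ?_)
    simp
  have hZm : ∀ m, Measurable (Z m) := fun m => (hSm _).div_const _
  have hZint : ∀ m, Integrable (fun ω => Z m ω ^ 2) μ := fun m => by
    refine Integrable.of_bound ((hZm m).pow_const 2).aestronglyMeasurable 1
      (ae_of_all _ fun ω => ?_)
    have h1 : |Z m ω| ≤ 1 := by
      simp only [hZ, abs_div]
      rw [abs_of_pos (by positivity : (0:ℝ) < ((m:ℝ) + 1) ^ 2), div_le_one (by positivity)]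
      exact_mod_cast hSb ((m + 1) ^ 2) ω
    rw [Real.norm_eq_abs, abs_pow]
    exact pow_le_one₀ (abs_nonneg _) h1
  have hZle : ∀ m : ℕ, ∫ ω, Z m ω ^ 2 ∂μ ≤ C * (1 / ((m : ℝ) + 1) ^ 2) := fun m => by
    have h1 := hC ((m + 1) ^ 2)
    have h2 : ∫ ω, Z m ω ^ 2 ∂μ
        = (∫ ω, (S ((m + 1) ^ 2) ω) ^ 2 ∂μ) * (1 / (((m : ℝ) + 1) ^ 2) ^ 2) := by
      rw [← integral_mul_const]
      congr 1 with ω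
      simp only [hZ]; field_simp
    rw [h2]
    calc _ ≤ (C * ((m + 1) ^ 2 : ℕ)) * (1 / (((m : ℝ) + 1) ^ 2) ^ 2) := by gcongr
      _ = _ := by push_cast; field_simp
  have hsum : Summable fun m : ℕ => C * (1 / ((m : ℝ) + 1) ^ 2) := by
    refine Summable.mul_left _ ?_
    have := (summable_nat_add_iff 1).2 (Real.summable_one_div_nat_pow.2 (one_lt_two))
    simpa using this
  have hfin : ∫⁻ ω, ∑' m, ENNReal.ofReal (Z m ω ^ 2) ∂μ ≠ ⊤ := by
    rw [lintegral_tsum fun m => ((hZm m).pow_const 2).ennreal_ofReal.aemeasurable]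
    refine ne_top_of_le_ne_top hsum.tsum_ofReal_ne_top (ENNReal.tsum_le_tsum fun m => ?_)
    rw [← ofReal_integral_eq_lintegral_ofReal (hZint m) (ae_of_all _ fun ω => sq_nonneg _)]
    exact ENNReal.ofReal_le_ofReal (hZle m)
  have hae := ae_lt_top (Measurable.tsum fun m => ((hZm m).pow_const 2).ennreal_ofReal) hfin
  filter_upwards [hae] with ω hω
  have h0 : Tendsto (fun m => Z m ω) atTop (𝓝 0) := by
    have h1 := ENNReal.tendsto_atTop_zero_of_tsum_ne_top hω.ne
    have h2 := (ENNReal.tendsto_toReal ENNReal.zero_ne_top).comp h1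
    have h3 : Tendsto (fun m => Z m ω ^ 2) atTop (𝓝 0) := by
      refine h2.congr fun m => ?_
      simp [ENNReal.toReal_ofReal (sq_nonneg (Z m ω))]
    have h4 := h3.sqrt
    simp only [Real.sqrt_sq_eq_abs, Real.sqrt_zero] at h4
    exact tendsto_zero_iff_abs_tendsto_zero _ |>.2 h4
  have hmono : Monotone fun n : ℕ => S n ω + n := by
    refine monotone_nat_of_le_succ fun n => ?_
    have := neg_le_of_abs_le (hb n ω)
    simp only [hS, Finset.sum_range_succ]
    push_cast
    linarith
  have hlim := tendsto_div_of_monotone_of_exists_subseq_tendsto_div (fun n : ℕ => S n ω + n) 1 hmono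
    (fun a ha => by
      refine ⟨fun m => (m + 1) ^ 2, ?_, ?_, ?_⟩
      · have h1 : Tendsto (fun m : ℕ => (1 + 1 / ((m : ℝ) + 1)) ^ 2) atTop (𝓝 ((1 + 0) ^ 2)) :=
          (tendsto_one_div_add_atTop_nhds_zero_nat.const_add 1).pow 2
        have h2 := (tendsto_order.1 h1).2 a (by simpa using ha)
        filter_upwards [h2] with m hm
        have h3 : (((m + 1 + 1) ^ 2 : ℕ) : ℝ)
            = (1 + 1 / ((m : ℝ) + 1)) ^ 2 * (((m + 1) ^ 2 : ℕ) : ℝ) := by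
          push_cast; field_simp
        rw [h3]
        gcongr
      · exact (tendsto_pow_atTop two_ne_zero).comp (tendsto_add_atTop_nat 1)
      · have : Tendsto (fun m => Z m ω + 1) atTop (𝓝 (0 + 1)) := h0.add_const 1
        rw [zero_add] at this
        refine this.congr fun m => ?_
        simp only [hZ]
        push_cast
        field_simp)
  have h5 := hlim.sub_const 1
  rw [sub_self] at h5
  refine h5.congr' ?_
  filter_upwards [eventually_gt_atTop 0] with n hn
  have : (n : ℝ) ≠ 0 := by positivity
  field_simp
  ring

/-- A strong law of large numbers for bounded variables with exponentially decaying
correlations. -/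
theorem ae_tendsto_average_zero_of_correlation {Ω : Type*} [MeasurableSpace Ω] {μ : Measure Ω}
    [IsFiniteMeasure μ] {Y : ℕ → Ω → ℝ} (hm : ∀ k, Measurable (Y k))
    (hb : ∀ k ω, |Y k ω| ≤ 1) {K r : ℝ} (hr0 : 0 ≤ r) (hr1 : r < 1)
    (hcor : ∀ j k, |∫ ω, Y j ω * Y (j + k) ω ∂μ| ≤ K * r ^ k) :
    ∀ᵐ ω ∂μ, Tendsto (fun n : ℕ => (∑ k ∈ Finset.range n, Y k ω) / n) atTop (𝓝 0) := by
  have hK : 0 ≤ K := by simpa using (abs_nonneg _).trans (hcor 0 0)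
  have hint : ∀ j k, Integrable (fun ω => Y j ω * Y k ω) μ := fun j k => by
    refine Integrable.of_bound ((hm j).mul (hm k)).aestronglyMeasurable 1 (ae_of_all _ fun ω => ?_)
    rw [norm_mul]
    exact mul_le_one₀ (hb j ω) (norm_nonneg _) (hb k ω)
  have hsq : ∀ n ω, (∑ k ∈ Finset.range n, Y k ω) ^ 2
      = ∑ j ∈ Finset.range n, ∑ k ∈ Finset.range n, Y j ω * Y k ω := fun n ω => by
    rw [sq, Finset.sum_mul_sum]
  have hintS : ∀ n, Integrable (fun ω => (∑ k ∈ Finset.range n, Y k ω) ^ 2) μ := fun n => by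
    simp only [hsq]
    exact integrable_finsetSum _ fun j _ => integrable_finsetSum _ fun k _ => hint j k
  refine ae_tendsto_average_zero hm hb (C := 2 * K / (1 - r)) fun n => ?_
  induction n with
  | zero => simp
  | succ n ih =>
    have e : ∀ ω, (∑ k ∈ Finset.range (n + 1), Y k ω) ^ 2 = (∑ k ∈ Finset.range n, Y k ω) ^ 2
        + (2 * ∑ j ∈ Finset.range n, Y j ω * Y n ω + Y n ω * Y n ω) := fun ω => by
      rw [Finset.sum_range_succ, ← Finset.sum_mul]
      ring
    have hint2 : Integrable (fun ω => ∑ j ∈ Finset.range n, Y j ω * Y n ω) μ :=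
      integrable_finsetSum _ fun j _ => hint j n
    have hint3 : Integrable (fun ω => 2 * ∑ j ∈ Finset.range n, Y j ω * Y n ω + Y n ω * Y n ω) μ :=
      (hint2.const_mul 2).add (hint n n)
    have hle : ∀ j ∈ Finset.range (n + 1), ∫ ω, Y j ω * Y n ω ∂μ ≤ K * r ^ (n - j) := fun j hj => by
      have h := (le_abs_self _).trans (hcor j (n - j))
      rwa [Nat.add_sub_cancel' (Nat.lt_succ_iff.1 (Finset.mem_range.1 hj))] at h
    have hgeom : ∑ j ∈ Finset.range (n + 1), K * r ^ (n - j) ≤ K / (1 - r) := by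
      rw [← Finset.mul_sum, div_eq_mul_inv, ← tsum_geometric_of_lt_one hr0 hr1]
      refine mul_le_mul_of_nonneg_left ?_ hK
      have := Finset.sum_range_reflect (fun i => r ^ i) (n + 1)
      simp only [Nat.add_sub_cancel] at this
      rw [this]
      exact (summable_geometric_of_lt_one hr0 hr1).sum_le_tsum _ fun i _ => pow_nonneg hr0 i
    have h1 := Finset.sum_le_sum hle
    rw [Finset.sum_range_succ] at h1
    have h2 : 0 ≤ ∫ ω, Y n ω * Y n ω ∂μ := integral_nonneg fun ω => mul_self_nonneg _
    simp only [e]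
    rw [integral_add (hintS n) hint3,
      integral_add (hint2.const_mul 2) (hint n n), integral_const_mul,
      integral_finsetSum _ fun j _ => hint j n]
    have h3 : 2 * K / (1 - r) * ((n + 1 : ℕ) : ℝ) = 2 * K / (1 - r) * n + 2 * (K / (1 - r)) := by
      push_cast
      ring
    rw [h3]
    linarith

/-- The inverse branches of the Gauss map. -/
theorem image_branch (n : ℕ) :
    (fun s : ℝ => 1 / (n + 1 + s)) '' Ico 0 1 = Ioc (1 / ((n : ℝ) + 2)) (1 / ((n : ℝ) + 1)) := by
  ext t
  constructor
  · rintro ⟨s, ⟨hs0, hs1⟩, rfl⟩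
    exact ⟨one_div_lt_one_div_of_lt (by positivity) (by linarith),
      one_div_le_one_div_of_le (by positivity) (by linarith)⟩
  · rintro ⟨h1, h2⟩
    have ht : 0 < t := lt_trans (by positivity) h1
    refine ⟨1 / t - (n + 1), ⟨?_, ?_⟩, ?_⟩
    · have := (le_one_div ht (by positivity)).1 h2
      linarith
    · have := (one_div_lt (by positivity) ht).1 h1
      linarith
    · field_simp
      ring

theorem iUnion_branch :
    ⋃ n : ℕ, Ioc (1 / ((n : ℝ) + 2)) (1 / ((n : ℝ) + 1)) = Ioc 0 1 := by
  ext t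
  simp only [mem_iUnion, mem_Ioc]
  constructor
  · rintro ⟨n, h1, h2⟩
    refine ⟨lt_trans (by positivity) h1, h2.trans ?_⟩
    rw [div_le_one (by positivity)]
    linarith [n.cast_nonneg (α := ℝ)]
  · rintro ⟨h0, h1⟩
    have h2 : 1 ≤ 1 / t := (one_le_div h0).2 h1
    have h3 : 1 ≤ ⌊1 / t⌋₊ := Nat.one_le_floor_iff _ |>.2 h2
    obtain ⟨n, hn⟩ := Nat.exists_eq_add_of_le' h3
    have h4 := Nat.floor_le (zero_le_one.trans h2)
    have h5 := Nat.lt_floor_add_one (1 / t)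
    rw [hn] at h4 h5
    push_cast at h4 h5
    refine ⟨n, (one_div_lt (by positivity) h0).2 (by linarith),
      (le_one_div h0 (by positivity)).2 h4⟩

theorem pairwise_disjoint_branch :
    Pairwise (Function.onFun Disjoint
      fun n : ℕ => Ioc (1 / ((n : ℝ) + 2)) (1 / ((n : ℝ) + 1))) := by
  have key : ∀ m n : ℕ, m < n → Disjoint (Ioc (1 / ((m : ℝ) + 2)) (1 / ((m : ℝ) + 1)))
      (Ioc (1 / ((n : ℝ) + 2)) (1 / ((n : ℝ) + 1))) := fun m n h => by
    rw [Set.disjoint_left]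
    rintro t ⟨h1, -⟩ ⟨-, h2⟩
    have h3 : (m : ℝ) + 1 ≤ n := by exact_mod_cast h
    have : 1 / ((n : ℝ) + 1) ≤ 1 / ((m : ℝ) + 2) :=
      one_div_le_one_div_of_le (by positivity) (by linarith)
    linarith
  intro m n h
  rcases lt_or_gt_of_ne h with h | h
  · exact key m n h
  · exact (key n m h).symm

/-- Change of variables along all inverse branches of the Gauss map. -/
theorem hasSum_integral_branch {F : ℝ → ℝ} (hF : IntegrableOn F (Ioo 0 1)) :
    HasSum (fun n : ℕ => ∫ s in Ioo (0:ℝ) 1, 1 / ((n : ℝ) + 1 + s) ^ 2 * F (1 / (n + 1 + s)))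
      (∫ t in Ioo (0:ℝ) 1, F t) := by
  have h := hasSum_integral_iUnion (μ := volume) (f := F)
    (fun n : ℕ => measurableSet_Ioc (a := 1 / ((n : ℝ) + 2)) (b := 1 / ((n : ℝ) + 1)))
    pairwise_disjoint_branch
    (by rwa [iUnion_branch, integrableOn_Ioc_iff_integrableOn_Ioo])
  rw [iUnion_branch, integral_Ioc_eq_integral_Ioo] at h
  refine h.congr_fun fun n => ?_
  rw [← image_branch, integral_image_eq_integral_abs_deriv_smul
    (f' := fun s => -1 / ((n : ℝ) + 1 + s) ^ 2) measurableSet_Ico, integral_Ico_eq_integral_Ioo]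
  · congr 1 with s
    rw [abs_div, abs_neg, abs_one, abs_of_nonneg (by positivity), smul_eq_mul]
  · intro s hs
    have hpos : (n : ℝ) + 1 + s ≠ 0 := by
      have := hs.1
      positivity
    have := (((hasDerivAt_id s).const_add ((n : ℝ) + 1)).fun_inv
      hpos).hasDerivWithinAt (s := Ico 0 1)
    simpa [one_div] using this
  · intro s hs t ht hst
    have h1 := hs.1
    have h2 := ht.1
    have h3 : (n : ℝ) + 1 + s = n + 1 + t := by
      have : 1 / ((n : ℝ) + 1 + s) = 1 / (n + 1 + t) := hst
      simpa using this
    linarith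

/-- The density on `(0, 1)` of the remainder `T^n x` given that `q_{n-1} / q_n = v`. -/
noncomputable def condDensity (v t : ℝ) : ℝ := (1 + v) / (1 + v * t) ^ 2

/-- The expectation of `G (T^n x)` given that `q_{n-1} / q_n = v`. -/
noncomputable def condExpect (v : ℝ) (G : ℝ → ℝ) : ℝ :=
  ∫ t in Ioo (0:ℝ) 1, condDensity v t * G t

/-- The probability that the next partial quotient is `n + 1` given that `q_{n-1} / q_n = v`. -/
noncomputable def digitProb (n : ℕ) (v : ℝ) : ℝ := (1 + v) / ((n + 1 + v) * (n + 2 + v))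

theorem condDensity_nonneg {v t : ℝ} (hv : 0 ≤ v) : 0 ≤ condDensity v t := by
  unfold condDensity; positivity

theorem continuousOn_condDensity {v : ℝ} (hv : 0 ≤ v) :
    ContinuousOn (condDensity v) (Icc 0 1) := by
  refine ContinuousOn.div (by fun_prop) (by fun_prop) fun t ht => ?_
  have := ht.1
  positivity

theorem integrableOn_condDensity_mul {v : ℝ} (hv : 0 ≤ v) {G : ℝ → ℝ} (hG : Measurable G) {B : ℝ}
    (hB : ∀ t, |G t| ≤ B) : IntegrableOn (fun t => condDensity v t * G t) (Ioo 0 1) := by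
  have h1 : IntegrableOn (condDensity v) (Ioo 0 1) :=
    ((continuousOn_condDensity hv).integrableOn_Icc).mono_set Ioo_subset_Icc_self
  exact h1.mul_bdd hG.aestronglyMeasurable (ae_of_all _ hB)

theorem integral_condDensity {v a b : ℝ} (hv : 0 ≤ v) (ha : 0 ≤ a) (hab : a ≤ b) :
    ∫ t in Ioc a b, condDensity v t = (1 + v) * b / (1 + v * b) - (1 + v) * a / (1 + v * a) := by
  rw [← intervalIntegral.integral_of_le hab]
  have hpos : ∀ t ∈ uIcc a b, 1 + v * t ≠ 0 := fun t ht => by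
    rw [uIcc_of_le hab] at ht
    have := ha.trans ht.1
    positivity
  refine intervalIntegral.integral_eq_sub_of_hasDerivAt
    (f := fun t => (1 + v) * t / (1 + v * t)) (fun t ht => ?_) ?_
  · have h1 := ((hasDerivAt_id t).const_mul (1 + v)).div
      (((hasDerivAt_id t).const_mul v).const_add 1) (hpos t ht)
    refine h1.congr_deriv ?_
    simp only [id, condDensity]
    congr 1
    ring
  · refine ContinuousOn.intervalIntegrable ?_
    refine ContinuousOn.div (by fun_prop) (by fun_prop) fun t ht => pow_ne_zero _ (hpos t ht)

theorem condExpect_one {v : ℝ} (hv : 0 ≤ v) : condExpect v (fun _ => 1) = 1 := by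
  simp only [condExpect, mul_one]
  rw [← integral_Ioc_eq_integral_Ioo, integral_condDensity hv le_rfl zero_le_one]
  field_simp
  simp

theorem condExpect_sub {v : ℝ} (hv : 0 ≤ v) {G H : ℝ → ℝ} (hG : Measurable G) (hH : Measurable H)
    {B : ℝ} (hGB : ∀ t, |G t| ≤ B) (hHB : ∀ t, |H t| ≤ B) :
    condExpect v (fun t => G t - H t) = condExpect v G - condExpect v H := by
  simp only [condExpect, mul_sub]
  exact integral_sub (integrableOn_condDensity_mul hv hG hGB)
    (integrableOn_condDensity_mul hv hH hHB)

theorem condExpect_const_mul (v c : ℝ) (G : ℝ → ℝ) :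
    condExpect v (fun t => c * G t) = c * condExpect v G := by
  simp only [condExpect, ← integral_const_mul]
  congr 1 with t
  ring

theorem condExpect_congr {v : ℝ} {G H : ℝ → ℝ} (h : ∀ t ∈ Ioo (0:ℝ) 1, G t = H t) :
    condExpect v G = condExpect v H :=
  setIntegral_congr_fun measurableSet_Ioo fun t ht => by simp only [h t ht]

theorem abs_condExpect_le {v : ℝ} (hv : 0 ≤ v) {G : ℝ → ℝ} {B : ℝ} (hB : ∀ t, |G t| ≤ B) :
    |condExpect v G| ≤ B := by
  have h1 : IntegrableOn (fun t => condDensity v t * B) (Ioo 0 1) :=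
    integrableOn_condDensity_mul hv measurable_const (B := |B|) fun _ => le_rfl
  have h2 : |condExpect v G| ≤ condExpect v fun _ => B := by
    refine (Real.norm_eq_abs _).symm.trans_le
      (norm_integral_le_of_norm_le h1 (ae_of_all _ fun t => ?_))
    rw [Real.norm_eq_abs, abs_mul, abs_of_nonneg (condDensity_nonneg hv)]
    exact mul_le_mul_of_nonneg_left (hB t) (condDensity_nonneg hv)
  refine h2.trans_eq ?_
  have := condExpect_const_mul v B fun _ => 1
  rw [condExpect_one hv] at this
  simpa using this

/-- Conditioning on the next partial quotient. -/
theorem hasSum_condExpect {v : ℝ} (hv : 0 ≤ v) {G : ℝ → ℝ} (hG : Measurable G) {B : ℝ}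
    (hB : ∀ t, |G t| ≤ B) :
    HasSum (fun n : ℕ => digitProb n v *
      condExpect (1 / (n + 1 + v)) fun s => G (1 / (n + 1 + s))) (condExpect v G) := by
  refine (hasSum_integral_branch (integrableOn_condDensity_mul hv hG hB)).congr_fun fun n => ?_
  rw [condExpect, ← integral_const_mul]
  refine setIntegral_congr_fun measurableSet_Ioo fun s hs => ?_
  have := hs.1
  simp only [condDensity, digitProb]
  field_simp
  ring

theorem digitProb_nonneg (n : ℕ) {v : ℝ} (hv : 0 ≤ v) : 0 ≤ digitProb n v := by
  unfold digitProb; positivity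

theorem digitProb_le_half (n : ℕ) {v : ℝ} (hv : 0 ≤ v) : digitProb n v ≤ 1 / 2 := by
  unfold digitProb
  rw [div_le_div_iff₀ (by positivity) (by positivity)]
  have : (0:ℝ) ≤ n := n.cast_nonneg
  nlinarith [mul_nonneg this hv, mul_nonneg this this, mul_nonneg hv hv]

theorem hasSum_digitProb {v : ℝ} (hv : 0 ≤ v) : HasSum (fun n => digitProb n v) 1 := by
  have h := hasSum_condExpect hv (G := fun _ => 1) measurable_const (B := 1) (by simp)
  rw [condExpect_one hv] at h
  convert h using 2 with n
  rw [condExpect_one (by positivity), mul_one]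

theorem digitProb_sub_eq (n : ℕ) {v w : ℝ} (hv : 0 ≤ v) (hw : 0 ≤ w) :
    digitProb n v - digitProb n w = (w - v) * (1 - n - (n : ℝ) ^ 2 + v + w + v * w) /
      ((n + 1 + v) * (n + 2 + v) * ((n + 1 + w) * (n + 2 + w))) := by
  unfold digitProb
  field_simp
  ring

/-- The distribution of the next partial quotient is stochastically monotone with a single
crossing at the digit `2`. -/
theorem digitProb_sub_mul_nonneg (n : ℕ) {v w : ℝ} (hv : 0 ≤ v) (hvw : v ≤ w) (hw : w ≤ 1) :
    0 ≤ (digitProb n v - digitProb n w) * (1 / ((n : ℝ) + 1 + w) - 1 / (2 + w)) := by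
  have hw0 := hv.trans hvw
  rw [digitProb_sub_eq n hv hw0]
  rcases n with _ | _ | n
  · refine mul_nonneg (div_nonneg (mul_nonneg (by linarith) ?_) (by positivity)) ?_
    · simp only [Nat.cast_zero]
      nlinarith [mul_nonneg hv hw0]
    · rw [sub_nonneg]
      exact one_div_le_one_div_of_le (by positivity) (by simp)
  · have : ((0 + 1 : ℕ) : ℝ) + 1 + w = 2 + w := by push_cast; ring
    rw [this, sub_self, mul_zero]
  · refine mul_nonneg_of_nonpos_of_nonpos
      (div_nonpos_of_nonpos_of_nonneg (mul_nonpos_of_nonneg_of_nonpos (by linarith) ?_)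
        (by positivity)) ?_
    · push_cast
      have hn : (0:ℝ) ≤ n := n.cast_nonneg
      nlinarith [mul_nonneg hv hw0, mul_le_one₀ (hvw.trans hw) hw0 hw, mul_nonneg hn hn]
    · rw [sub_nonpos]
      refine one_div_le_one_div_of_le (by positivity) ?_
      push_cast
      have hn : (0:ℝ) ≤ n := n.cast_nonneg
      linarith

theorem digitProb_mul_add (n : ℕ) {v : ℝ} (hv : 0 ≤ v) :
    digitProb n v * (1 / (n + 1 + v)) + digitProb n v = (1 + v) / ((n : ℝ) + 1 + v) ^ 2 := by
  unfold digitProb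
  field_simp
  ring

/-- The Markov operator of the chain `q_{n-1} / q_n` contracts Lipschitz constants. -/
theorem lipschitz_of_hasSum_digitProb {h H : ℝ → ℝ} {L : ℝ}
    (hL : ∀ a ∈ Icc (0:ℝ) 1, ∀ b ∈ Icc (0:ℝ) 1, |h a - h b| ≤ L * |a - b|)
    (hH : ∀ v ∈ Icc (0:ℝ) 1, HasSum (fun n : ℕ => digitProb n v * h (1 / (n + 1 + v))) (H v)) :
    ∀ v ∈ Icc (0:ℝ) 1, ∀ w ∈ Icc (0:ℝ) 1, |H v - H w| ≤ 253 / 256 * L * |v - w| := by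
  have hL0 : 0 ≤ L := by
    have := (abs_nonneg _).trans (hL 0 (by simp) 1 (by simp))
    simpa using this
  have hmem : ∀ (n : ℕ) {v : ℝ}, 0 ≤ v → 1 / ((n : ℝ) + 1 + v) ∈ Icc (0:ℝ) 1 := fun n v hv => by
    refine ⟨by positivity, (div_le_one (by positivity)).2 ?_⟩
    linarith [n.cast_nonneg (α := ℝ)]
  have key : ∀ v ∈ Icc (0:ℝ) 1, ∀ w ∈ Icc (0:ℝ) 1, v ≤ w →
      |H v - H w| ≤ 253 / 256 * L * (w - v) := by
    rintro v ⟨hv0, hv1⟩ w ⟨hw0, hw1⟩ hvw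
    set q := (1 + v) * (1 + w) with hq
    have hq1 : 1 ≤ q := by nlinarith
    have hq4 : q ≤ 4 := by nlinarith
    set D := h (1 / (2 + w)) with hD
    set u : ℕ → ℝ := fun n => if n = 0 then (w - v) / q else if n = 1 then (w - v) * (q - 1) / 16
      else if n = 2 then -((w - v) * (4 - q) / 256) else 0 with hu
    have hu_sum : HasSum u ((w - v) / q + (w - v) * (q - 1) / 16 - (w - v) * (4 - q) / 256) := by
      have : HasSum u _ := hasSum_sum_of_ne_finset_zero (s := Finset.range 3) fun n hn => by
        rw [Finset.mem_range] at hn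
        simp only [hu]
        rw [if_neg (by omega), if_neg (by omega), if_neg (by omega)]
      convert this using 1
      simp [hu, Finset.sum_range_succ]
      ring
    have hu_le : ∀ n : ℕ, (1 + v) / ((n : ℝ) + 1 + v) ^ 2 - (1 + w) / ((n : ℝ) + 1 + w) ^ 2
        ≤ u n := fun n => by
      have e : (1 + v) / ((n : ℝ) + 1 + v) ^ 2 - (1 + w) / ((n : ℝ) + 1 + w) ^ 2
          = (w - v) * (q - n ^ 2) / (((n : ℝ) + 1 + v) ^ 2 * ((n : ℝ) + 1 + w) ^ 2) := by
        rw [hq]; field_simp; ring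
      rw [e]
      have hd : 0 ≤ w - v := sub_nonneg.2 hvw
      rcases n with _ | _ | _ | n
      · simp only [hu, if_true]
        apply le_of_eq
        rw [hq]; push_cast; field_simp; ring
      · simp only [hu]
        norm_num
        refine div_le_div_of_nonneg_left (mul_nonneg hd (by linarith)) (by norm_num) ?_
        have h1 : (2:ℝ) ^ 2 ≤ (1 + 1 + v) ^ 2 := by gcongr; linarith
        have h2 : (2:ℝ) ^ 2 ≤ (1 + 1 + w) ^ 2 := by gcongr; linarith
        nlinarith
      · simp only [hu]
        norm_num
        have h1 : (3 + v) ^ 2 ≤ (4:ℝ) ^ 2 := by gcongr; linarith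
        have h2 : (3 + w) ^ 2 ≤ (4:ℝ) ^ 2 := by gcongr; linarith
        have h3 : (3 + v) ^ 2 * (3 + w) ^ 2 ≤ (256:ℝ) :=
          (mul_le_mul h1 h2 (by positivity) (by positivity)).trans_eq (by norm_num)
        have h4 := div_le_div_of_nonneg_left (mul_nonneg hd (by linarith : 0 ≤ 4 - q))
          (by positivity) h3
        have h5 : (w - v) * (q - 4) / ((3 + v) ^ 2 * (3 + w) ^ 2)
          = -((w - v) * (4 - q) / ((3 + v) ^ 2 * (3 + w) ^ 2)) := by ring
        rw [h5]
        linarith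
      · simp only [hu]
        norm_num
        refine div_nonpos_of_nonpos_of_nonneg (mul_nonpos_of_nonneg_of_nonpos hd ?_)
          (by positivity)
        have hn : (0:ℝ) ≤ n := n.cast_nonneg
        nlinarith
    have hp := (hasSum_digitProb hv0).sub (hasSum_digitProb hw0)
    rw [sub_self] at hp
    have hsum := ((hH v ⟨hv0, hv1⟩).sub (hH w ⟨hw0, hw1⟩)).sub (hp.mul_right D)
    rw [zero_mul, sub_zero] at hsum
    have hbd := (hu_sum.sub (hp.mul_right (1 / (2 + w) + 1))).mul_left L
    rw [zero_mul, sub_zero] at hbd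
    refine (hsum.norm_le_of_bounded hbd fun n => ?_).trans ?_
    · set x := 1 / ((n : ℝ) + 1 + v)
      set y := 1 / ((n : ℝ) + 1 + w)
      set z := 1 / (2 + w)
      have hz : z ∈ Icc (0:ℝ) 1 := by
        have := hmem 1 hw0
        have e : ((1 : ℕ) : ℝ) + 1 + w = 2 + w := by push_cast; ring
        rwa [e] at this
      have hyx : y ≤ x := one_div_le_one_div_of_le (by positivity) (by linarith)
      have h1 := hL x (hmem n hv0) y (hmem n hw0)
      rw [abs_of_nonneg (sub_nonneg.2 hyx)] at h1
      have h2 := hL y (hmem n hw0) z hz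
      have h3 := digitProb_sub_mul_nonneg n hv0 hvw hw1
      have h4 := digitProb_nonneg n hv0
      have h5 := hu_le n
      rw [← digitProb_mul_add n hv0, ← digitProb_mul_add n hw0] at h5
      rw [Real.norm_eq_abs]
      calc |digitProb n v * h x - digitProb n w * h y - (digitProb n v - digitProb n w) * D|
          = |digitProb n v * (h x - h y) + (digitProb n v - digitProb n w) * (h y - D)| := by
            congr 1; ring
        _ ≤ digitProb n v * |h x - h y| + |digitProb n v - digitProb n w| * |h y - D| := by
            refine (abs_add_le _ _).trans_eq ?_
            rw [abs_mul, abs_mul, abs_of_nonneg h4]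
        _ ≤ digitProb n v * (L * (x - y)) + |digitProb n v - digitProb n w| * (L * |y - z|) := by
            gcongr
        _ = L * (digitProb n v * (x - y) + (digitProb n v - digitProb n w) * (y - z)) := by
            have : |digitProb n v - digitProb n w| * |y - z|
                = (digitProb n v - digitProb n w) * (y - z) := by
              rw [← abs_mul, abs_of_nonneg h3]
            linear_combination L * this
        _ ≤ _ := by
            refine mul_le_mul_of_nonneg_left ?_ hL0
            linarith
    · have e : (w - v) / q + (w - v) * (q - 1) / 16 - (w - v) * (4 - q) / 256
          ≤ 253 / 256 * (w - v) := by
        have hq0 : 0 < q := by linarith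
        have e1 : 1 / q ≤ 253 / 256 - (q - 1) / 16 + (4 - q) / 256 := by
          rw [div_le_iff₀ hq0]
          nlinarith
        have e2 : (w - v) / q = (w - v) * (1 / q) := by ring
        rw [e2]
        nlinarith [mul_le_mul_of_nonneg_left e1 (sub_nonneg.2 hvw)]
      calc _ ≤ L * (253 / 256 * (w - v)) := mul_le_mul_of_nonneg_left e hL0
        _ = _ := by ring
  intro v hv w hw
  rcases le_total v w with hvw | hvw
  · rw [abs_sub_comm v w, abs_of_nonneg (sub_nonneg.2 hvw)]
    exact key v hv w hw hvw
  · rw [abs_sub_comm (H v), abs_of_nonneg (sub_nonneg.2 hvw)]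
    exact key w hw v hv hvw

/-- The Gauss measure is stationary for the chain `q_{n-1} / q_n`. -/
theorem integral_div_eq_of_hasSum_digitProb {h H : ℝ → ℝ} (hc : ContinuousOn h (Icc 0 1))
    (hH : ∀ v ∈ Icc (0:ℝ) 1, HasSum (fun n : ℕ => digitProb n v * h (1 / (n + 1 + v))) (H v)) :
    ∫ v in Ioo (0:ℝ) 1, H v / (1 + v) = ∫ v in Ioo (0:ℝ) 1, h v / (1 + v) := by
  have hF : ContinuousOn (fun v => h v / (1 + v)) (Icc 0 1) :=
    hc.div (by fun_prop) fun v hv => by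
      have := hv.1
      positivity
  have h1 := hasSum_integral_branch (hF.integrableOn_Icc.mono_set Ioo_subset_Icc_self)
  have h2 := hasSum_integral_branch (hF.norm.integrableOn_Icc.mono_set Ioo_subset_Icc_self)
  have hint : ∀ n : ℕ, IntegrableOn (fun s : ℝ => 1 / ((n : ℝ) + 1 + s) ^ 2 *
      (h (1 / (n + 1 + s)) / (1 + 1 / (n + 1 + s)))) (Ioo 0 1) := fun n => by
    refine (ContinuousOn.integrableOn_Icc ?_).mono_set Ioo_subset_Icc_self
    have hne : ∀ s ∈ Icc (0:ℝ) 1, (n : ℝ) + 1 + s ≠ 0 := fun s hs => by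
      have := hs.1
      positivity
    refine ContinuousOn.mul (ContinuousOn.div (by fun_prop) (by fun_prop)
      fun s hs => pow_ne_zero _ (hne s hs)) ?_
    refine hF.comp (f := fun s : ℝ => 1 / ((n : ℝ) + 1 + s))
      (ContinuousOn.div (by fun_prop) (by fun_prop) hne) fun s hs => ?_
    have := hs.1
    refine ⟨by positivity, (div_le_one (by positivity)).2 ?_⟩
    linarith [n.cast_nonneg (α := ℝ)]
  have h3 := hasSum_integral_of_summable_integral_norm hint (h2.summable.congr fun n => by
    refine setIntegral_congr_fun measurableSet_Ioo fun s hs => ?_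
    have := hs.1
    simp only [norm_mul]
    rw [Real.norm_of_nonneg (by positivity : 0 ≤ 1 / ((n : ℝ) + 1 + s) ^ 2)])
  rw [← h3.unique h1]
  refine setIntegral_congr_fun measurableSet_Ioo fun v hv => ?_
  have hv0 := hv.1
  refine Eq.symm (((hH v ⟨hv.1.le, hv.2.le⟩).div_const (1 + v)).congr_fun fun n => ?_).tsum_eq
  simp only [digitProb]
  field_simp
  ring

theorem integral_one_div_one_add : ∫ v in Ioo (0:ℝ) 1, 1 / (1 + v) = Real.log 2 := by
  rw [← integral_Ioc_eq_integral_Ioo, ← intervalIntegral.integral_of_le zero_le_one,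
    intervalIntegral.integral_eq_sub_of_hasDerivAt (f := fun v => Real.log (1 + v))]
  · norm_num
  · intro v hv
    rw [uIcc_of_le zero_le_one] at hv
    have := hv.1
    exact ((hasDerivAt_id v).const_add 1).log (by simp only [id]; positivity)
  · refine ContinuousOn.intervalIntegrable (ContinuousOn.div (by fun_prop) (by fun_prop) ?_)
    intro v hv
    rw [uIcc_of_le zero_le_one] at hv
    have := hv.1
    positivity

/-- The natural extension of the Gauss map,
`(T^n x, q_{n-1} / q_n) ↦ (T^{n+1} x, q_n / q_{n+1})`. -/
noncomputable def gaussNE (p : ℝ × ℝ) : ℝ × ℝ := (gaussMap p.1, 1 / (⌊1 / p.1⌋ + p.2))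

theorem measurable_gaussNE : Measurable gaussNE := by
  unfold gaussNE gaussMap
  refine Measurable.prodMk (by fun_prop)
    (Measurable.div (by fun_prop) (Measurable.add ?_ (by fun_prop)))
  exact (measurable_from_top (f := fun n : ℤ => (n : ℝ))).comp
    (Int.measurable_floor.comp (by fun_prop))

theorem floor_branch (n : ℕ) {s : ℝ} (hs : s ∈ Ioo (0:ℝ) 1) :
    ⌊1 / (1 / ((n : ℝ) + 1 + s))⌋ = (n : ℤ) + 1 := by
  rw [one_div_one_div, Int.floor_eq_iff]
  push_cast
  exact ⟨by linarith [hs.1], by linarith [hs.2]⟩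

theorem gaussNE_branch (n : ℕ) {s : ℝ} (hs : s ∈ Ioo (0:ℝ) 1) (v : ℝ) :
    gaussNE (1 / (n + 1 + s), v) = (s, 1 / (n + 1 + v)) := by
  simp only [gaussNE, gaussMap, Int.fract, floor_branch n hs]
  push_cast
  rw [one_div_one_div]
  congr 1
  ring

theorem hasSum_condExpect_gaussNE {v : ℝ} (hv : 0 ≤ v) {φ : ℝ → ℝ} {g : ℝ × ℝ → ℝ}
    (hφ : Measurable φ) (hg : Measurable g) {B : ℝ} (hφB : ∀ t, |φ t| ≤ 1) (hgB : ∀ p, |g p| ≤ B) :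
    HasSum (fun n : ℕ => digitProb n v *
      condExpect (1 / (n + 1 + v)) fun s => φ (1 / (n + 1 + s)) * g (s, 1 / (n + 1 + v)))
      (condExpect v fun t => φ t * g (gaussNE (t, v))) := by
  have h := hasSum_condExpect hv (G := fun t => φ t * g (gaussNE (t, v)))
    (hφ.mul (hg.comp (measurable_gaussNE.comp measurable_prodMk_right))) (B := B) fun t => by
      rw [abs_mul]
      exact (mul_le_of_le_one_left (abs_nonneg _) (hφB t)).trans (hgB _)
  refine h.congr_fun fun n => ?_
  congr 1
  refine condExpect_congr fun s hs => ?_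
  rw [gaussNE_branch n hs]

theorem one_div_mem_Icc (n : ℕ) {v : ℝ} (hv : 0 ≤ v) : 1 / ((n : ℝ) + 1 + v) ∈ Icc (0:ℝ) 1 := by
  refine ⟨by positivity, (div_le_one (by positivity)).2 ?_⟩
  linarith [n.cast_nonneg (α := ℝ)]

/-- The indicator of `θ ≤ z`, where `θ_n = T^n x / (1 + T^n x * (q_{n-1} / q_n))`. -/
noncomputable def thetaInd (z : ℝ) (p : ℝ × ℝ) : ℝ :=
  {p : ℝ × ℝ | p.1 / (1 + p.1 * p.2) ≤ z}.indicator 1 p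

theorem measurable_thetaInd (z : ℝ) : Measurable (thetaInd z) :=
  measurable_one.indicator (measurableSet_le (by fun_prop) measurable_const)

theorem thetaInd_mem_Icc (z : ℝ) (p : ℝ × ℝ) : thetaInd z p ∈ Icc (0:ℝ) 1 := by
  unfold thetaInd indicator
  split_ifs <;> simp

theorem abs_thetaInd_le (z : ℝ) (p : ℝ × ℝ) : |thetaInd z p| ≤ 1 := by
  have := thetaInd_mem_Icc z p
  rw [abs_of_nonneg this.1]
  exact this.2

/-- For fixed `v`, the condition `θ ≤ z` cuts out an initial segment. -/
theorem exists_threshold {z v : ℝ} (hz : z ∈ Icc (0:ℝ) 1) (hv : v ∈ Icc (0:ℝ) 1) :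
    ∃ τ ∈ Icc (0:ℝ) 1, (1 + v) * τ / (1 + v * τ) = min 1 ((1 + v) * z) ∧
      ∀ t ∈ Ioo (0:ℝ) 1, thetaInd z (t, v) = (Iic τ).indicator 1 t := by
  obtain ⟨hz0, hz1⟩ := hz
  obtain ⟨hv0, hv1⟩ := hv
  suffices h : ∃ τ ∈ Icc (0:ℝ) 1, (1 + v) * τ / (1 + v * τ) = min 1 ((1 + v) * z) ∧
      ∀ t ∈ Ioo (0:ℝ) 1, t / (1 + t * v) ≤ z ↔ t ≤ τ by
    obtain ⟨τ, h1, h2, h3⟩ := h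
    refine ⟨τ, h1, h2, fun t ht => ?_⟩
    simp only [thetaInd, indicator, mem_ofPred_eq, mem_Iic, h3 t ht]
    rfl
  rcases le_or_gt 1 ((1 + v) * z) with h | h
  · refine ⟨1, by simp, ?_, fun t ht => ⟨fun _ => ht.2.le, fun _ => ?_⟩⟩
    · rw [min_eq_left h]
      field_simp
    · have ht0 := ht.1
      have ht1 := ht.2
      rw [div_le_iff₀ (by positivity)]
      nlinarith [mul_nonneg ht0.le hv0, mul_nonneg hz0 hv0]
  · have hzv : 0 < 1 - v * z := by nlinarith
    have hne := hzv.ne'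
    refine ⟨z / (1 - v * z), ⟨by positivity, (div_le_one hzv).2 (by linarith)⟩, ?_, fun t ht => ?_⟩
    · rw [min_eq_right h.le]
      have e : 1 + v * (z / (1 - v * z)) = 1 / (1 - v * z) := by
        field_simp
        ring
      rw [e]
      field_simp
    · have ht0 := ht.1
      rw [div_le_iff₀ (by positivity), le_div_iff₀ hzv]
      constructor <;> intro h <;> linarith

/-- The conditional probability of `θ_{n+k} ≤ z` given that `q_{n-1} / q_n = v`. -/
noncomputable def thetaProb (z : ℝ) (k : ℕ) (v : ℝ) : ℝ :=
  condExpect v fun t => thetaInd z (gaussNE^[k] (t, v))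

theorem thetaProb_zero {z v : ℝ} (hz : z ∈ Icc (0:ℝ) 1) (hv : v ∈ Icc (0:ℝ) 1) :
    thetaProb z 0 v = min 1 ((1 + v) * z) := by
  obtain ⟨τ, hτ, h1, h2⟩ := exists_threshold hz hv
  change condExpect v (fun t => thetaInd z (t, v)) = _
  rw [condExpect_congr h2, ← h1, condExpect,
    ← integral_Ioc_eq_integral_Ioo]
  have e : (fun t => condDensity v t * (Iic τ).indicator 1 t)
      = (Iic τ).indicator (condDensity v) := by
    ext t
    by_cases ht : t ∈ Iic τ <;> simp [ht]
  rw [e, setIntegral_indicator measurableSet_Iic]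
  have e2 : Ioc 0 1 ∩ Iic τ = Ioc 0 τ := by
    ext t
    simp only [mem_inter_iff, mem_Ioc, mem_Iic]
    exact ⟨fun h => ⟨h.1.1, h.2⟩, fun h => ⟨⟨h.1, h.2.trans hτ.2⟩, h.2⟩⟩
  rw [e2, integral_condDensity hv.1 le_rfl hτ.1]
  simp

theorem hasSum_thetaProb (z : ℝ) (k : ℕ) {v : ℝ} (hv : 0 ≤ v) :
    HasSum (fun n : ℕ => digitProb n v * thetaProb z k (1 / (n + 1 + v)))
      (thetaProb z (k + 1) v) := by
  have := hasSum_condExpect_gaussNE hv (φ := fun _ => 1) (g := fun p => thetaInd z (gaussNE^[k] p))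
    measurable_const ((measurable_thetaInd z).comp (measurable_gaussNE.iterate k)) (B := 1)
    (by simp) fun p => abs_thetaInd_le z _
  simp only [one_mul] at this
  exact this

theorem thetaProb_lipschitz {z : ℝ} (hz : z ∈ Icc (0:ℝ) 1) (k : ℕ) :
    ∀ v ∈ Icc (0:ℝ) 1, ∀ w ∈ Icc (0:ℝ) 1,
      |thetaProb z k v - thetaProb z k w| ≤ (253 / 256) ^ k * |v - w| := by
  induction k with
  | zero =>
    intro v hv w hw
    rw [thetaProb_zero hz hv, thetaProb_zero hz hw]
    refine (abs_min_sub_min_le_max _ _ _ _).trans (max_le (by simp) ?_)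
    have : (1 + v) * z - (1 + w) * z = (v - w) * z := by ring
    rw [this, abs_mul, abs_of_nonneg hz.1, pow_zero, one_mul]
    exact mul_le_of_le_one_right (abs_nonneg _) hz.2
  | succ k ih =>
    rw [pow_succ']
    exact lipschitz_of_hasSum_digitProb ih fun v hv => hasSum_thetaProb z k hv.1

theorem continuousOn_thetaProb {z : ℝ} (hz : z ∈ Icc (0:ℝ) 1) (k : ℕ) :
    ContinuousOn (thetaProb z k) (Icc 0 1) := by
  refine LipschitzOnWith.continuousOn (K := ⟨(253 / 256) ^ k, by positivity⟩)
    (LipschitzOnWith.of_dist_le_mul fun v hv w hw => ?_)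
  exact thetaProb_lipschitz hz k v hv w hw

/-- The asymptotic frequency of `θ_n ≤ z`. -/
noncomputable def thetaFreq (z : ℝ) : ℝ :=
  (∫ v in Ioo (0:ℝ) 1, min 1 ((1 + v) * z) / (1 + v)) / Real.log 2

theorem integral_thetaProb {z : ℝ} (hz : z ∈ Icc (0:ℝ) 1) (k : ℕ) :
    ∫ v in Ioo (0:ℝ) 1, thetaProb z k v / (1 + v) = thetaFreq z * Real.log 2 := by
  induction k with
  | zero =>
    rw [thetaFreq, div_mul_cancel₀ _ (Real.log_pos one_lt_two).ne']
    refine setIntegral_congr_fun measurableSet_Ioo fun v hv => ?_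
    simp only [thetaProb_zero hz ⟨hv.1.le, hv.2.le⟩]
  | succ k ih =>
    rw [← ih]
    exact integral_div_eq_of_hasSum_digitProb (continuousOn_thetaProb hz k)
      fun v hv => hasSum_thetaProb z k hv.1

theorem abs_thetaProb_sub_le {z : ℝ} (hz : z ∈ Icc (0:ℝ) 1) (k : ℕ) {v : ℝ}
    (hv : v ∈ Icc (0:ℝ) 1) : |thetaProb z k v - thetaFreq z| ≤ (253 / 256) ^ k := by
  have hlog := Real.log_pos one_lt_two
  have hone : ContinuousOn (fun w : ℝ => 1 / (1 + w)) (Icc 0 1) :=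
    ContinuousOn.div (by fun_prop) (by fun_prop) fun w hw => by
      have := hw.1
      positivity
  have hint1 : IntegrableOn (fun w : ℝ => 1 / (1 + w)) (Ioo 0 1) :=
    hone.integrableOn_Icc.mono_set Ioo_subset_Icc_self
  have hint2 : IntegrableOn (fun w : ℝ => thetaProb z k w / (1 + w)) (Ioo 0 1) := by
    refine (ContinuousOn.integrableOn_Icc ?_).mono_set Ioo_subset_Icc_self
    exact (continuousOn_thetaProb hz k).div (by fun_prop) fun w hw => by
      have := hw.1
      positivity
  have e : (thetaProb z k v - thetaFreq z) * Real.log 2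
      = ∫ w in Ioo (0:ℝ) 1, (thetaProb z k v * (1 / (1 + w)) - thetaProb z k w / (1 + w)) := by
    rw [integral_sub (hint1.const_mul _) hint2, integral_const_mul, integral_one_div_one_add,
      integral_thetaProb hz]
    ring
  have h : |(thetaProb z k v - thetaFreq z) * Real.log 2| ≤ (253 / 256) ^ k * Real.log 2 := by
    rw [e, ← integral_one_div_one_add, ← integral_const_mul]
    refine (Real.norm_eq_abs _).symm.trans_le (norm_integral_le_of_norm_le (hint1.const_mul _) ?_)
    filter_upwards [ae_restrict_mem measurableSet_Ioo] with w hw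
    have hw0 := hw.1
    have h1 := thetaProb_lipschitz hz k v hv w ⟨hw.1.le, hw.2.le⟩
    have h2 : |v - w| ≤ 1 := abs_le.2 ⟨by linarith [hv.1, hw.2], by linarith [hv.2]⟩
    rw [Real.norm_eq_abs, mul_one_div, ← sub_div, abs_div, abs_of_pos (by linarith : 0 < 1 + w),
      mul_one_div]
    refine div_le_div_of_nonneg_right (h1.trans ?_) (by linarith)
    exact mul_le_of_le_one_right (by positivity) h2
  rw [abs_mul, abs_of_pos hlog] at h
  exact le_of_mul_le_mul_right h hlog

/-- Closed rays of the real line. -/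
def IsRay (A : Set ℝ) : Prop := ∃ τ, A = Iic τ ∨ A = Ici τ

theorem IsRay.measurableSet {A : Set ℝ} (hA : IsRay A) : MeasurableSet A := by
  obtain ⟨τ, rfl | rfl⟩ := hA
  exacts [measurableSet_Iic, measurableSet_Ici]

theorem IsRay.branch {A : Set ℝ} (hA : IsRay A) (n : ℕ) :
    ∃ A', IsRay A' ∧ ∀ s ∈ Ioo (0:ℝ) 1, 1 / ((n : ℝ) + 1 + s) ∈ A ↔ s ∈ A' := by
  obtain ⟨τ, hτ⟩ := hA
  rcases le_or_gt τ 0 with h0 | h0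
  · rcases hτ with rfl | rfl
    · refine ⟨Iic 0, ⟨0, Or.inl rfl⟩, fun s hs => iff_of_false ?_ ?_⟩
      · have := hs.1
        have : 0 < 1 / ((n : ℝ) + 1 + s) := by positivity
        simp only [mem_Iic, not_le]
        linarith
      · simp [hs.1]
    · refine ⟨Ici 0, ⟨0, Or.inr rfl⟩, fun s hs => iff_of_true ?_ hs.1.le⟩
      have := hs.1
      have : 0 < 1 / ((n : ℝ) + 1 + s) := by positivity
      exact h0.trans this.le
  · rcases hτ with rfl | rfl
    · refine ⟨Ici (1 / τ - (n + 1)), ⟨_, Or.inr rfl⟩, fun s hs => ?_⟩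
      have := hs.1
      rw [mem_Iic, mem_Ici, one_div_le (by positivity) h0, sub_le_iff_le_add, add_comm s]
    · refine ⟨Iic (1 / τ - (n + 1)), ⟨_, Or.inl rfl⟩, fun s hs => ?_⟩
      have := hs.1
      rw [mem_Iic, mem_Ici, le_one_div h0 (by positivity), le_sub_iff_add_le, add_comm s]

/-- All branches but one map `(0, 1)` inside a given ray or its complement. -/
theorem IsRay.exists_cut {A : Set ℝ} (hA : IsRay A) :
    ∃ m : ℕ, ∀ n, n ≠ m → (∀ s ∈ Ioo (0:ℝ) 1, 1 / ((n : ℝ) + 1 + s) ∈ A) ∨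
      ∀ s ∈ Ioo (0:ℝ) 1, 1 / ((n : ℝ) + 1 + s) ∉ A := by
  obtain ⟨τ, hτ⟩ := hA
  refine ⟨⌊1 / τ⌋₊ - 1, fun n hn => ?_⟩
  have key : (∀ s ∈ Ioo (0:ℝ) 1, 1 / ((n : ℝ) + 1 + s) < τ) ∨
      ∀ s ∈ Ioo (0:ℝ) 1, τ < 1 / ((n : ℝ) + 1 + s) := by
    rcases le_or_gt τ 0 with h0 | h0
    · right
      intro s hs
      have := hs.1
      exact h0.trans_lt (by positivity)
    · rcases le_or_gt (1 / τ) (n + 1) with h1 | h1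
      · left
        intro s hs
        have := hs.1
        rw [one_div_lt (by positivity) h0]
        linarith
      · rcases le_or_gt ((n : ℝ) + 2) (1 / τ) with h2 | h2
        · right
          intro s hs
          have := hs.1
          rw [lt_one_div h0 (by positivity)]
          linarith [hs.2]
        · refine absurd ?_ hn
          have : ⌊1 / τ⌋₊ = n + 1 := by
            rw [Nat.floor_eq_iff (by positivity)]
            push_cast
            exact ⟨h1.le, by linarith⟩
          omega
  rcases hτ with rfl | rfl <;> rcases key with h | h
  · exact Or.inl fun s hs => (h s hs).le
  · exact Or.inr fun s hs => not_le.2 (h s hs)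
  · exact Or.inr fun s hs => not_le.2 (h s hs)
  · exact Or.inl fun s hs => (h s hs).le

theorem abs_indicator_one_le (A : Set ℝ) (t : ℝ) : |A.indicator (1 : ℝ → ℝ) t| ≤ 1 := by
  unfold indicator
  split_ifs <;> simp

section Correlation

variable {Y : ℝ × ℝ → ℝ}

/-- Decay of correlations against indicators of rays. -/
theorem abs_condExpect_indicator_mul_le (hY : Measurable Y) (hY1 : ∀ p, |Y p| ≤ 1)
    (hdecay : ∀ k : ℕ, ∀ v ∈ Icc (0:ℝ) 1,
      |condExpect v fun t => Y (gaussNE^[k] (t, v))| ≤ (253 / 256) ^ k) (k : ℕ) :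
    ∀ A, IsRay A → ∀ v ∈ Icc (0:ℝ) 1,
      |condExpect v fun t => A.indicator 1 t * Y (gaussNE^[k] (t, v))| ≤ 3 * (253 / 256) ^ k := by
  induction k with
  | zero =>
    intro A hA v hv
    refine (abs_condExpect_le hv.1 (B := 1) fun t => ?_).trans (by norm_num)
    rw [abs_mul]
    exact mul_le_one₀ (abs_indicator_one_le A t) (abs_nonneg _) (hY1 _)
  | succ k ih =>
    intro A hA v hv
    have hsum := hasSum_condExpect_gaussNE hv.1 (φ := A.indicator 1)
      (g := fun p => Y (gaussNE^[k] p)) (measurable_one.indicator hA.measurableSet)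
      (hY.comp (measurable_gaussNE.iterate k)) (B := 1) (abs_indicator_one_le A) fun p => hY1 _
    obtain ⟨m, hm⟩ := hA.exists_cut
    set r : ℝ := (253 / 256) ^ k with hr
    have hr0 : 0 < r := by positivity
    have hbd : HasSum (fun n => digitProb n v * r + if n = m then digitProb m v * (2 * r) else 0)
        (1 * r + digitProb m v * (2 * r)) :=
      ((hasSum_digitProb hv.1).mul_right r).add (hasSum_ite_eq m _)
    refine (hsum.norm_le_of_bounded hbd fun n => ?_).trans ?_
    · rw [Real.norm_eq_abs, abs_mul, abs_of_nonneg (digitProb_nonneg n hv.1)]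
      have hp := digitProb_nonneg n hv.1
      by_cases hnm : n = m
      · subst hnm
        rw [if_pos rfl, ← mul_add]
        refine mul_le_mul_of_nonneg_left ?_ hp
        obtain ⟨A', hA', h⟩ := hA.branch n
        rw [condExpect_congr (H := fun s => A'.indicator 1 s *
          Y (gaussNE^[k] (s, 1 / ((n : ℝ) + 1 + v)))) fun s hs => by
            simp only [indicator, h s hs]; rfl]
        refine (ih A' hA' _ (one_div_mem_Icc n hv.1)).trans_eq ?_
        ring
      · rw [if_neg hnm, add_zero]
        refine mul_le_mul_of_nonneg_left ?_ hp
        rcases hm n hnm with h | h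
        · rw [condExpect_congr (H := fun s => Y (gaussNE^[k] (s, 1 / ((n : ℝ) + 1 + v))))
            fun s hs => by rw [indicator_of_mem (h s hs), Pi.one_apply, one_mul]]
          exact hdecay k _ (one_div_mem_Icc n hv.1)
        · rw [condExpect_congr (H := fun _ => 0)
            fun s hs => by rw [indicator_of_notMem (h s hs), zero_mul]]
          simpa [condExpect] using hr0.le
    · have := digitProb_le_half m hv.1
      rw [pow_succ]
      nlinarith

/-- Shifting both times in a correlation does not increase a uniform bound. -/
theorem abs_condExpect_mul_shift_le (hY : Measurable Y) (hY1 : ∀ p, |Y p| ≤ 1) {k : ℕ} {b : ℝ}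
    (h : ∀ v ∈ Icc (0:ℝ) 1, |condExpect v fun t => Y (t, v) * Y (gaussNE^[k] (t, v))| ≤ b)
    (j : ℕ) : ∀ v ∈ Icc (0:ℝ) 1, |condExpect v fun t =>
      Y (gaussNE^[j] (t, v)) * Y (gaussNE^[j + k] (t, v))| ≤ b := by
  induction j with
  | zero => simpa using h
  | succ j ih =>
    intro v hv
    have hsum := hasSum_condExpect_gaussNE hv.1 (φ := fun _ => 1)
      (g := fun p => Y (gaussNE^[j] p) * Y (gaussNE^[j + k] p)) measurable_const
      ((hY.comp (measurable_gaussNE.iterate j)).mul (hY.comp (measurable_gaussNE.iterate (j + k))))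
      (B := 1) (by simp) fun p => by
        rw [abs_mul]
        exact mul_le_one₀ (hY1 _) (abs_nonneg _) (hY1 _)
    simp only [one_mul] at hsum
    have e : j + 1 + k = (j + k) + 1 := by ring
    simp only [e, Function.iterate_succ_apply]
    refine (hsum.norm_le_of_bounded ((hasSum_digitProb hv.1).mul_right b) fun n => ?_).trans_eq
      (one_mul b)
    rw [Real.norm_eq_abs, abs_mul, abs_of_nonneg (digitProb_nonneg n hv.1)]
    exact mul_le_mul_of_nonneg_left (ih _ (one_div_mem_Icc n hv.1)) (digitProb_nonneg n hv.1)

end Correlation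

theorem thetaFreq_mem_Icc {z : ℝ} (hz : z ∈ Icc (0:ℝ) 1) : thetaFreq z ∈ Icc (0:ℝ) 1 := by
  have hp : ∀ k, thetaProb z k 0 ∈ Icc (0:ℝ) 1 := fun k => by
    refine ⟨setIntegral_nonneg measurableSet_Ioo fun t _ =>
      mul_nonneg (condDensity_nonneg le_rfl) (thetaInd_mem_Icc z _).1, ?_⟩
    exact (le_abs_self _).trans (abs_condExpect_le le_rfl fun t => abs_thetaInd_le z _)
  have hlim : Tendsto (fun k => thetaProb z k 0) atTop (𝓝 (thetaFreq z)) := by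
    rw [tendsto_iff_norm_sub_tendsto_zero]
    exact squeeze_zero (fun k => norm_nonneg _) (fun k => abs_thetaProb_sub_le hz k (by simp))
      (tendsto_pow_atTop_nhds_zero_of_lt_one (by norm_num) (by norm_num))
  exact isClosed_Icc.mem_of_tendsto hlim (Eventually.of_forall hp)

theorem ae_tendsto_average_thetaInd {z : ℝ} (hz : z ∈ Icc (0:ℝ) 1) :
    ∀ᵐ x ∂(volume.restrict (Ioo (0:ℝ) 1)),
      Tendsto (fun n : ℕ => (∑ k ∈ Finset.range n, thetaInd z (gaussNE^[k] (x, 0))) / n) atTop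
        (𝓝 (thetaFreq z)) := by
  set c := thetaFreq z with hc
  have hc01 : c ∈ Icc (0:ℝ) 1 := thetaFreq_mem_Icc hz
  set Y : ℝ × ℝ → ℝ := fun p => thetaInd z p - c with hYdef
  have hY : Measurable Y := (measurable_thetaInd z).sub_const c
  have hY1 : ∀ p, |Y p| ≤ 1 := fun p => by
    have := thetaInd_mem_Icc z p
    exact abs_le.2 ⟨by linarith [this.1, hc01.2], by linarith [this.2, hc01.1]⟩
  have hmeas : ∀ {g : ℝ × ℝ → ℝ}, Measurable g → ∀ (k : ℕ) (v : ℝ),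
      Measurable fun t => g (gaussNE^[k] (t, v)) := fun hg k v =>
    hg.comp ((measurable_gaussNE.iterate k).comp measurable_prodMk_right)
  have hdecay : ∀ k : ℕ, ∀ v ∈ Icc (0:ℝ) 1,
      |condExpect v fun t => Y (gaussNE^[k] (t, v))| ≤ (253 / 256) ^ k := fun k v hv => by
    have h1 := condExpect_sub hv.1 (hmeas (measurable_thetaInd z) k v)
      (measurable_const (a := c)) (B := 1) (fun t => abs_thetaInd_le z _)
      fun t => by rw [abs_of_nonneg hc01.1]; exact hc01.2
    have h2 := condExpect_const_mul v c fun _ => 1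
    rw [condExpect_one hv.1] at h2
    simp only [mul_one] at h2
    rw [h2] at h1
    simp only [hYdef]
    rw [h1]
    exact abs_thetaProb_sub_le hz k hv
  have hcor0 : ∀ k : ℕ, ∀ v ∈ Icc (0:ℝ) 1,
      |condExpect v fun t => Y (t, v) * Y (gaussNE^[k] (t, v))| ≤ 4 * (253 / 256) ^ k :=
    fun k v hv => by
      obtain ⟨τ, -, -, hτ⟩ := exists_threshold hz hv
      have hray : IsRay (Iic τ) := ⟨τ, Or.inl rfl⟩
      have hYm := hmeas hY k v
      have e : (condExpect v fun t => Y (t, v) * Y (gaussNE^[k] (t, v)))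
          = (condExpect v fun t => (Iic τ).indicator 1 t * Y (gaussNE^[k] (t, v)))
            - c * condExpect v fun t => Y (gaussNE^[k] (t, v)) := by
        have hm1 : Measurable fun t =>
            (Iic τ).indicator (1 : ℝ → ℝ) t * Y (gaussNE^[k] (t, v)) :=
          (measurable_one.indicator measurableSet_Iic).mul hYm
        have hm2 : Measurable fun t => c * Y (gaussNE^[k] (t, v)) := hYm.const_mul c
        rw [← condExpect_const_mul, ← condExpect_sub hv.1 hm1 hm2 (B := 1)]
        · refine condExpect_congr fun t ht => ?_
          rw [← hτ t ht]
          simp only [hYdef]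
          ring
        · intro t
          rw [abs_mul]
          exact mul_le_one₀ (abs_indicator_one_le _ t) (abs_nonneg _) (hY1 _)
        · intro t
          rw [abs_mul, abs_of_nonneg hc01.1]
          exact mul_le_one₀ hc01.2 (abs_nonneg _) (hY1 _)
      rw [e]
      refine (abs_sub _ _).trans ?_
      have h1 := abs_condExpect_indicator_mul_le hY hY1 hdecay k _ hray v hv
      have h2 := hdecay k v hv
      rw [abs_mul, abs_of_nonneg hc01.1]
      have h3 := mul_le_of_le_one_left (abs_nonneg
        (condExpect v fun t => Y (gaussNE^[k] (t, v)))) hc01.2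
      linarith
  have h := ae_tendsto_average_zero_of_correlation (μ := volume.restrict (Ioo (0:ℝ) 1))
    (Y := fun k x => Y (gaussNE^[k] (x, 0))) (fun k => hmeas hY k 0) (fun k x => hY1 _)
    (K := 4) (r := 253 / 256) (by norm_num) (by norm_num) fun j k => by
      have := abs_condExpect_mul_shift_le hY hY1 (hcor0 k) j 0 (by simp)
      simpa [condExpect, condDensity] using this
  filter_upwards [h] with x hx
  have h1 := hx.add_const c
  rw [zero_add] at h1
  refine h1.congr' ?_
  filter_upwards [eventually_gt_atTop 0] with n hn
  have : (n : ℝ) ≠ 0 := by positivity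
  simp only [hYdef, Finset.sum_sub_distrib, Finset.sum_const, Finset.card_range, nsmul_eq_mul]
  field_simp
  ring

theorem integrableOn_thetaFreq (z : ℝ) :
    IntegrableOn (fun v : ℝ => min 1 ((1 + v) * z) / (1 + v)) (Icc 0 1) :=
  (ContinuousOn.div (by fun_prop) (by fun_prop) fun v hv => by
    have := hv.1
    positivity).integrableOn_Icc

theorem thetaFreq_eq {z : ℝ} (hz : z ∈ Icc (0:ℝ) 1) : thetaFreq z =
    if z ≤ 1/2 then z / Real.log 2 else (1 - z + Real.log (2 * z)) / Real.log 2 := by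
  obtain ⟨hz0, hz1⟩ := hz
  rw [thetaFreq, ← apply_ite (fun y => y / Real.log 2)]
  congr 1
  split_ifs with h
  · have : ∀ v ∈ Ioo (0:ℝ) 1, min 1 ((1 + v) * z) / (1 + v) = z := fun v hv => by
      have hv0 := hv.1
      rw [min_eq_right (by nlinarith [hv.2]), mul_div_cancel_left₀ _ (by positivity)]
    rw [setIntegral_congr_fun measurableSet_Ioo this]
    simp
  · rw [not_le] at h
    have hz0 : 0 < z := by linarith
    set c := 1 / z - 1 with hc
    have hc0 : 0 ≤ c := by
      rw [hc, sub_nonneg, le_div_iff₀ hz0]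
      linarith
    have hc1 : c ≤ 1 := by
      rw [hc, sub_le_iff_le_add, div_le_iff₀ hz0]
      linarith
    have hcz : (1 + c) * z = 1 := by
      rw [hc]
      field_simp
      ring
    have hint := integrableOn_thetaFreq z
    have hI : ∀ a b : ℝ, 0 ≤ a → a ≤ b → b ≤ 1 →
        IntervalIntegrable (fun v : ℝ => min 1 ((1 + v) * z) / (1 + v)) volume a b :=
      fun a b ha hab hb => (intervalIntegrable_iff_integrableOn_Ioc_of_le hab).2
        (hint.mono_set fun v hv => ⟨ha.trans hv.1.le, hv.2.trans hb⟩)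
    rw [← integral_Ioc_eq_integral_Ioo, ← intervalIntegral.integral_of_le zero_le_one,
      ← intervalIntegral.integral_add_adjacent_intervals (hI 0 c le_rfl hc0 hc1)
        (hI c 1 hc0 hc1 le_rfl)]
    have e1 : ∫ v in (0:ℝ)..c, min 1 ((1 + v) * z) / (1 + v) = ∫ _ in (0:ℝ)..c, z := by
      refine intervalIntegral.integral_congr fun v hv => ?_
      rw [uIcc_of_le hc0] at hv
      have hv0 := hv.1
      have : (1 + v) * z ≤ 1 := by
        rw [← hcz]
        exact mul_le_mul_of_nonneg_right (by linarith [hv.2]) hz0.le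
      simp only [min_eq_right this]
      exact mul_div_cancel_left₀ _ (by positivity)
    have e2 : ∫ v in c..1, min 1 ((1 + v) * z) / (1 + v) = ∫ v in c..1, 1 / (1 + v) := by
      refine intervalIntegral.integral_congr fun v hv => ?_
      rw [uIcc_of_le hc1] at hv
      have : 1 ≤ (1 + v) * z := by
        rw [← hcz]
        exact mul_le_mul_of_nonneg_right (by linarith [hv.1]) hz0.le
      simp only [min_eq_left this]
    have e3 : ∫ v in c..1, 1 / (1 + v) = Real.log 2 - Real.log (1 + c) := by
      have hpos : ∀ v ∈ uIcc c 1, 1 + v ≠ 0 := fun v hv => by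
        rw [uIcc_of_le hc1] at hv
        have := hc0.trans hv.1
        positivity
      rw [intervalIntegral.integral_eq_sub_of_hasDerivAt (f := fun v => Real.log (1 + v))]
      · norm_num
      · intro v hv
        exact ((hasDerivAt_id v).const_add 1).log (hpos v hv)
      · exact (ContinuousOn.div (by fun_prop) (by fun_prop) hpos).intervalIntegrable
    rw [e1, e2, e3, intervalIntegral.integral_const, eq_div_of_mul_eq hz0.ne' hcz,
      Real.log_mul two_ne_zero hz0.ne', one_div, Real.log_inv, smul_eq_mul]
    linarith

theorem abs_thetaFreq_sub_le (z w : ℝ) :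
    |thetaFreq z - thetaFreq w| ≤ |z - w| / Real.log 2 := by
  have hlog := Real.log_pos one_lt_two
  rw [thetaFreq, thetaFreq, ← sub_div, abs_div, abs_of_pos hlog]
  refine div_le_div_of_nonneg_right ?_ hlog.le
  have hint : ∀ z, IntegrableOn (fun v : ℝ => min 1 ((1 + v) * z) / (1 + v)) (Ioo 0 1) :=
    fun z => (integrableOn_thetaFreq z).mono_set Ioo_subset_Icc_self
  rw [← integral_sub (hint z) (hint w)]
  have h := norm_setIntegral_le_of_norm_le_const (μ := volume) (s := Ioo (0:ℝ) 1)
    (f := fun v => min 1 ((1 + v) * z) / (1 + v) - min 1 ((1 + v) * w) / (1 + v))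
    (C := |z - w|) (by simp) fun v hv => ?_
  · simpa using h
  · have hv0 : 0 < 1 + v := by linarith [hv.1]
    rw [Real.norm_eq_abs, ← sub_div, abs_div, abs_of_pos hv0, div_le_iff₀ hv0]
    refine (abs_min_sub_min_le_max _ _ _ _).trans (max_le (by simp; positivity) ?_)
    rw [← mul_sub, abs_mul, abs_of_pos hv0, mul_comm]

theorem continuous_thetaFreq : Continuous thetaFreq := by
  have hlog := Real.log_pos one_lt_two
  refine LipschitzWith.continuous (K := ⟨1 / Real.log 2, by positivity⟩)
    (LipschitzWith.of_dist_le_mul fun z w => ?_)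
  rw [Real.dist_eq, Real.dist_eq]
  refine (abs_thetaFreq_sub_le z w).trans_eq ?_
  change _ = 1 / Real.log 2 * _
  ring

theorem gaussMap_irrational {x : ℝ} (hx : Irrational x) : Irrational (gaussMap x) := by
  have h : Irrational (1 / x) := by simpa using hx.inv
  rw [gaussMap, Int.fract]
  exact h.sub_intCast _

theorem gaussMap_mem_Ioo {x : ℝ} (hx : Irrational x) : gaussMap x ∈ Ioo (0:ℝ) 1 :=
  ⟨(Int.fract_nonneg _).lt_of_ne (gaussMap_irrational hx).ne_zero.symm, Int.fract_lt_one _⟩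

theorem iterate_gaussMap {x : ℝ} (hx : x ∈ Ioo (0:ℝ) 1) (hirr : Irrational x) (n : ℕ) :
    Irrational (gaussMap^[n] x) ∧ gaussMap^[n] x ∈ Ioo (0:ℝ) 1 := by
  induction n with
  | zero => exact ⟨hirr, hx⟩
  | succ n ih =>
    rw [Function.iterate_succ_apply']
    exact ⟨gaussMap_irrational ih.1, gaussMap_mem_Ioo ih.1⟩

theorem pquot_pos {x : ℝ} (hx : x ∈ Ioo (0:ℝ) 1) (hirr : Irrational x) (n : ℕ) :
    1 ≤ pquot x n := by
  obtain ⟨-, h0, h1⟩ := iterate_gaussMap hx hirr n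
  rw [pquot, Int.le_floor, Int.cast_one]
  exact (one_le_div h0).2 h1.le

theorem one_div_iterate_gaussMap (x : ℝ) (n : ℕ) :
    1 / gaussMap^[n] x = pquot x n + gaussMap^[n + 1] x := by
  rw [Function.iterate_succ_apply', pquot, gaussMap, Int.floor_add_fract]

theorem qden_mono {x : ℝ} (hx : x ∈ Ioo (0:ℝ) 1) (hirr : Irrational x) (n : ℕ) :
    0 ≤ qden x n ∧ qden x n ≤ qden x (n + 1) ∧ 0 < qden x (n + 1) := by
  induction n with
  | zero => simp [qden]
  | succ n ih =>
    have ha := pquot_pos hx hirr n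
    obtain ⟨h0, h1, h2⟩ := ih
    have h3 : qden x (n + 1) ≤ qden x (n + 2) := by
      rw [qden]
      nlinarith
    exact ⟨h2.le, h3, h2.trans_le h3⟩

theorem iterate_gaussNE {x : ℝ} (hx : x ∈ Ioo (0:ℝ) 1) (hirr : Irrational x) (n : ℕ) :
    gaussNE^[n] (x, 0) = (gaussMap^[n] x, (qden x n : ℝ) / qden x (n + 1)) := by
  induction n with
  | zero => simp [qden]
  | succ n ih =>
    have h1 : (0 : ℝ) < qden x (n + 1) := by exact_mod_cast (qden_mono hx hirr n).2.2
    have h2 : (0 : ℝ) < qden x (n + 2) := by exact_mod_cast (qden_mono hx hirr (n + 1)).2.2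
    rw [Function.iterate_succ_apply', ih, gaussNE, Function.iterate_succ_apply']
    congr 1
    change 1 / ((pquot x n : ℝ) + _) = _
    have e : (qden x (n + 2) : ℝ) = pquot x n * qden x (n + 1) + qden x n := by
      rw [qden]
      push_cast
      rfl
    rw [e] at h2 ⊢
    field_simp

theorem mul_qden_add {x : ℝ} (hx : x ∈ Ioo (0:ℝ) 1) (hirr : Irrational x) (n : ℕ) :
    x * (qden x (n + 1) + qden x n * gaussMap^[n] x)
      = pnum x (n + 1) + pnum x n * gaussMap^[n] x := by
  induction n with
  | zero => simp [qden, pnum]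
  | succ n ih =>
    have ht := (iterate_gaussMap hx hirr n).2.1
    have h := one_div_iterate_gaussMap x n
    rw [div_eq_iff ht.ne'] at h
    rw [qden, pnum]
    push_cast
    refine mul_right_cancel₀ ht.ne' ?_
    linear_combination ih + (pnum x (n + 1) - x * qden x (n + 1)) * h

theorem abs_det_eq_one (x : ℝ) (n : ℕ) :
    |pnum x n * qden x (n + 1) - pnum x (n + 1) * qden x n| = 1 := by
  induction n with
  | zero => simp [qden, pnum]
  | succ n ih =>
    rw [← ih, abs_sub_comm, qden, pnum]
    congr 1
    ring

theorem thetaRCF_eq {x : ℝ} (hx : x ∈ Ioo (0:ℝ) 1) (hirr : Irrational x) (n : ℕ) :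
    thetaRCF x n = gaussMap^[n] x /
      (1 + gaussMap^[n] x * ((qden x n : ℝ) / qden x (n + 1))) := by
  have hq : (0 : ℝ) < qden x (n + 1) := by exact_mod_cast (qden_mono hx hirr n).2.2
  have hq' : (0 : ℝ) ≤ qden x n := by exact_mod_cast (qden_mono hx hirr n).1
  have ht := (iterate_gaussMap hx hirr n).2.1
  have hdet : |(pnum x n * qden x (n + 1) - pnum x (n + 1) * qden x n : ℝ)| = 1 := by
    exact_mod_cast abs_det_eq_one x n
  have hx' := mul_qden_add hx hirr n
  set t := gaussMap^[n] x
  have hD : 0 < (qden x (n + 1) + qden x n * t : ℝ) := by positivity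
  have e : x - (pnum x (n + 1) : ℝ) / qden x (n + 1)
      = (pnum x n * qden x (n + 1) - pnum x (n + 1) * qden x n) *
        (t / (qden x (n + 1) * (qden x (n + 1) + qden x n * t))) := by
    rw [← mul_div_assoc, sub_div' hq.ne', div_eq_div_iff hq.ne' (by positivity)]
    linear_combination (qden x (n + 1) : ℝ) ^ 2 * hx'
  rw [thetaRCF, e, abs_mul, hdet, one_mul, abs_of_pos (by positivity)]
  field_simp

theorem thetaInd_iterate_gaussNE {x : ℝ} (hx : x ∈ Ioo (0:ℝ) 1) (hirr : Irrational x) (z : ℝ)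
    (n : ℕ) : thetaInd z (gaussNE^[n] (x, 0)) = if thetaRCF x n ≤ z then 1 else 0 := by
  rw [thetaRCF_eq hx hirr, iterate_gaussNE hx hirr, thetaInd, indicator]
  rfl

theorem thetaRCF_mem_Ioo {x : ℝ} (hx : x ∈ Ioo (0:ℝ) 1) (hirr : Irrational x) (n : ℕ) :
    0 < thetaRCF x n ∧ thetaRCF x n < 1 := by
  obtain ⟨ht0, ht1⟩ := (iterate_gaussMap hx hirr n).2
  have hq : (0 : ℝ) < qden x (n + 1) := by exact_mod_cast (qden_mono hx hirr n).2.2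
  have hq' : (0 : ℝ) ≤ qden x n := by exact_mod_cast (qden_mono hx hirr n).1
  rw [thetaRCF_eq hx hirr]
  have h : 0 ≤ gaussMap^[n] x * ((qden x n : ℝ) / qden x (n + 1)) := by positivity
  refine ⟨by positivity, (div_lt_one (by positivity)).2 (by linarith)⟩

theorem tendsto_of_tendsto_rat {f : ℝ → ℕ → ℝ} {g : ℝ → ℝ} (hg : Continuous g)
    (hmono : ∀ n, Monotone fun z => f z n)
    (h : ∀ r : ℚ, (r : ℝ) ∈ Icc (0:ℝ) 1 → Tendsto (f r) atTop (𝓝 (g r))) {z : ℝ}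
    (hz : z ∈ Icc (0:ℝ) 1) : Tendsto (f z) atTop (𝓝 (g z)) := by
  rcases hz.1.eq_or_lt with rfl | h0
  · simpa using h 0 (by simp)
  rcases hz.2.eq_or_lt with rfl | h1
  · simpa using h 1 (by simp)
  refine tendsto_order.2 ⟨fun a ha => ?_, fun a ha => ?_⟩
  · obtain ⟨l, hl, hlz⟩ := exists_Ioc_subset_of_mem_nhds (hg.tendsto z (Ioi_mem_nhds ha)) ⟨0, h0⟩
    obtain ⟨r, hr1, hr2⟩ := exists_rat_btwn (max_lt hl h0)
    rw [max_lt_iff] at hr1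
    filter_upwards [(tendsto_order.1 (h r ⟨hr1.2.le, hr2.le.trans hz.2⟩)).1 a
      (hlz ⟨hr1.1, hr2.le⟩)] with n hn
    exact hn.trans_le (hmono n hr2.le)
  · obtain ⟨u, hu, huz⟩ := exists_Ico_subset_of_mem_nhds (hg.tendsto z (Iio_mem_nhds ha)) ⟨1, h1⟩
    obtain ⟨r, hr1, hr2⟩ := exists_rat_btwn (lt_min hu h1)
    rw [lt_min_iff] at hr2
    filter_upwards [(tendsto_order.1 (h r ⟨hz.1.trans hr1.le, hr2.2.le⟩)).2 a
      (huz ⟨hr1.le, hr2.1⟩)] with n hn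
    exact (hmono n hr1.le).trans_lt hn

end DoeblinLenstra

/-- Doeblin–Lenstra: `0 < θ_n(x) < 1` always and, for a.e. `x`, the limiting distribution of
`(θ_n(x))` is `z ↦ z/log 2` on `[0,1/2]` and `z ↦ (1 − z + log(2z))/log 2` on `[1/2,1]`. -/
theorem stmt_6 :
    (∀ x : ℝ, x ∈ Set.Ioo (0:ℝ) 1 → Irrational x → ∀ n : ℕ,
        0 < thetaRCF x n ∧ thetaRCF x n < 1) ∧
    ∀ᵐ x ∂(volume : Measure ℝ), x ∈ Set.Ioo (0:ℝ) 1 → Irrational x →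
      ∀ z : ℝ, z ∈ Set.Icc (0:ℝ) 1 →
        Tendsto (fun n : ℕ =>
            (((Finset.range n).filter fun k => thetaRCF x k ≤ z).card : ℝ) / (n : ℝ))
          atTop (𝓝 (if z ≤ 1/2 then z / Real.log 2
                    else (1 - z + Real.log (2 * z)) / Real.log 2)) := by
  refine ⟨fun x hx hirr n => DoeblinLenstra.thetaRCF_mem_Ioo hx hirr n, ?_⟩
  have h : ∀ᵐ x ∂(volume : Measure ℝ), ∀ r : ℚ, (r : ℝ) ∈ Set.Icc (0:ℝ) 1 →
      x ∈ Set.Ioo (0:ℝ) 1 → Tendsto (fun n : ℕ => (∑ k ∈ Finset.range n,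
        DoeblinLenstra.thetaInd r (DoeblinLenstra.gaussNE^[k] (x, 0))) / n) atTop
          (𝓝 (DoeblinLenstra.thetaFreq r)) := by
    refine ae_all_iff.2 fun r => ?_
    by_cases hr : (r : ℝ) ∈ Set.Icc (0:ℝ) 1
    · filter_upwards [(ae_restrict_iff' measurableSet_Ioo).1
        (DoeblinLenstra.ae_tendsto_average_thetaInd hr)] with x hx _ using hx
    · exact ae_of_all _ fun x h => absurd h hr
  filter_upwards [h] with x hx hx01 hirr z hz
  rw [← DoeblinLenstra.thetaFreq_eq hz]
  refine DoeblinLenstra.tendsto_of_tendsto_rat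
    (f := fun z n => (((Finset.range n).filter fun k => thetaRCF x k ≤ z).card : ℝ) / (n : ℝ))
    DoeblinLenstra.continuous_thetaFreq (fun n a b hab => ?_) (fun r hr => ?_) hz
  · refine div_le_div_of_nonneg_right ?_ n.cast_nonneg
    exact_mod_cast Finset.card_le_card
      (Finset.monotone_filter_right _ fun k _ hk => le_trans hk hab)
  · refine (hx r hr hx01).congr fun n => ?_
    simp only [DoeblinLenstra.thetaInd_iterate_gaussNE hx01 hirr, Finset.sum_boole]
end
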